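/- Let G be a finite simple d-regular graph with d ≠ 1 (equivalently, a regular graph no component of which is isomorphic to K_2). Then G admits an edge labelling ℓ : E(G) → {1,2,3} such that for every edge uv of G, the product of the labels of the edges incident to u differs from the product of the labels of the edges incident to v. -/

import Mathlib

open Finset

/-- The product of the labels assigned by `ℓ` to the edges incident to `v`
(an empty product equals `1`). -/
def vertexProd {V : Type*} [Fintype V] [DecidableEq V] (G : SimpleGraph V)
    [DecidableRel G.Adj] (ℓ : Sym2 V → ℕ) (v : V) : ℕ :=
  ∏ e ∈ G.incidenceFinset v, ℓ e

namespace MulLab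

open Classical in
/-- Number of elements satisfying a predicate. -/
noncomputable def cnt {V : Type*} [Fintype V] (P : V → Prop) : ℕ :=
  (Finset.univ.filter P).card

section basic
variable {V : Type*} [Fintype V]

lemma cnt_congr {P Q : V → Prop} (h : ∀ x, P x ↔ Q x) : cnt P = cnt Q := by
  have : P = Q := funext fun x => propext (h x)
  rw [this]

lemma cnt_eq_zero {P : V → Prop} : cnt P = 0 ↔ ∀ x, ¬ P x := by
  simp [cnt, Finset.filter_eq_empty_iff]

lemma cnt_pos {P : V → Prop} : 0 < cnt P ↔ ∃ x, P x := by
  rw [Nat.pos_iff_ne_zero, Ne, cnt_eq_zero]; push Not; rfl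

lemma cnt_or {P Q : V → Prop} (h : ∀ x, P x → ¬ Q x) :
    cnt (fun x => P x ∨ Q x) = cnt P + cnt Q := by
  classical
  unfold cnt
  rw [← Finset.card_union_of_disjoint]
  · congr 1; ext x; simp
  · rw [Finset.disjoint_left]; intro x; simpa using h x

lemma cnt_eq (a : V) : cnt (fun x => x = a) = 1 := by
  classical
  unfold cnt
  rw [Finset.card_eq_one]; exact ⟨a, by ext; simp⟩

lemma cnt_mem (s : Finset V) : cnt (fun x => x ∈ s) = s.card := by
  classical
  unfold cnt
  congr 1; ext; simp

lemma cnt_mono {P Q : V → Prop} (h : ∀ x, P x → Q x) : cnt P ≤ cnt Q := by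
  classical
  unfold cnt
  apply Finset.card_le_card
  intro x; simpa using h x

lemma cnt_eq_one {P : V → Prop} : cnt P = 1 ↔ ∃ a, ∀ x, P x ↔ x = a := by
  classical
  unfold cnt
  rw [Finset.card_eq_one]
  constructor
  · rintro ⟨a, h⟩
    refine ⟨a, fun x => ?_⟩
    have := congrArg (fun s => x ∈ s) h
    simpa using this
  · rintro ⟨a, h⟩
    exact ⟨a, by ext x; simp [h]⟩

lemma two_le_cnt {P : V → Prop} : 2 ≤ cnt P ↔ ∃ a b, a ≠ b ∧ P a ∧ P b := by
  classical
  unfold cnt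
  rw [show 2 ≤ _ ↔ 1 < (Finset.univ.filter P).card from Iff.rfl, Finset.one_lt_card]
  constructor
  · rintro ⟨a, ha, b, hb, h⟩; exact ⟨a, b, h, by simpa using ha, by simpa using hb⟩
  · rintro ⟨a, b, h, ha, hb⟩; exact ⟨a, by simpa using ha, b, by simpa using hb, h⟩

lemma cnt_and_const {P : V → Prop} (q : Prop) [Decidable q] :
    cnt (fun x => q ∧ P x) = if q then cnt P else 0 := by
  split_ifs with h
  · exact cnt_congr (by simp [h])
  · rw [cnt_eq_zero]; simp [h]

lemma cnt_cast_eq (P : V → Prop) [DecidablePred P] :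
    (cnt P : ZMod 2) = ∑ x, if P x then 1 else 0 := by
  unfold cnt
  rw [Finset.sum_boole]
  congr!

end basic

section tjoin
variable {V : Type*} [Fintype V] [DecidableEq V]

lemma zmod2_cases (a : ZMod 2) : a = 0 ∨ a = 1 := by
  revert a; decide

lemma zmod2_add_self (a : ZMod 2) : a + a = 0 := by
  revert a; decide

lemma path_join (G : SimpleGraph V) {u v : V} (h : G.Reachable u v) :
    ∃ f : V → V → ZMod 2, (∀ x y, f x y = f y x) ∧ (∀ x y, f x y ≠ 0 → G.Adj x y) ∧
      ∀ x, ∑ y, f x y = (if x = u then 1 else 0) + (if x = v then 1 else 0) := by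
  obtain ⟨p⟩ := h
  induction p with
  | nil =>
    refine ⟨fun _ _ => 0, by simp, by simp, fun x => ?_⟩
    simp [zmod2_add_self]
  | @cons a b c hab p ih =>
    obtain ⟨f, h1, h2, h3⟩ := ih
    have hne : a ≠ b := hab.ne
    refine ⟨fun x y => f x y + ((if x = a ∧ y = b then 1 else 0) + (if x = b ∧ y = a then 1 else 0)),
      fun x y => ?_, fun x y hxy => ?_, fun x => ?_⟩
    · show f x y + _ = f y x + _
      rw [h1 x y]; congr 1; rw [add_comm]; congr 1 <;> simp [and_comm]
    · by_contra hn
      have e1 : f x y = 0 := by by_contra h; exact hn (h2 x y h)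
      have e2 : ¬ (x = a ∧ y = b) := by rintro ⟨rfl, rfl⟩; exact hn hab
      have e3 : ¬ (x = b ∧ y = a) := by rintro ⟨rfl, rfl⟩; exact hn hab.symm
      simp [e1, e2, e3] at hxy
    · rw [Finset.sum_add_distrib, Finset.sum_add_distrib, h3]
      have e1 : (∑ y, if x = a ∧ y = b then (1 : ZMod 2) else 0) = if x = a then 1 else 0 := by
        by_cases h : x = a <;> simp [h]
      have e2 : (∑ y, if x = b ∧ y = a then (1 : ZMod 2) else 0) = if x = b then 1 else 0 := by
        by_cases h : x = b <;> simp [h]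
      rw [e1, e2]
      have := zmod2_add_self (if x = b then (1 : ZMod 2) else 0)
      linear_combination this

/-- General T-join lemma with roots. -/
lemma tjoin_gen (G : SimpleGraph V) (L : V → Prop) [DecidablePred L] (ρ : V → V)
    (hρ : ∀ v, L v → G.Reachable v (ρ v)) (t : V → ZMod 2) :
    ∃ F : V → V → Prop, (∀ x y, F x y → F y x) ∧ (∀ x y, F x y → G.Adj x y) ∧
      ∀ x, (cnt (F x) : ZMod 2) =
        ∑ v, if L v then t v * ((if x = v then 1 else 0) + (if x = ρ v then 1 else 0)) else 0 := by
  have key : ∀ v, ∃ f : V → V → ZMod 2, L v → ((∀ x y, f x y = f y x) ∧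
      (∀ x y, f x y ≠ 0 → G.Adj x y) ∧
      ∀ x, ∑ y, f x y = (if x = v then 1 else 0) + (if x = ρ v then 1 else 0)) := by
    intro v
    by_cases h : L v
    · obtain ⟨f, hf⟩ := path_join G (hρ v h)
      exact ⟨f, fun _ => hf⟩
    · exact ⟨fun _ _ => 0, fun h' => absurd h' h⟩
  choose f hf using key
  let g : V → V → ZMod 2 := fun x y => ∑ v, if L v then t v * f v x y else 0
  refine ⟨fun x y => g x y = 1, fun x y h => ?_, fun x y h => ?_, fun x => ?_⟩
  · rw [← h]
    apply Finset.sum_congr rfl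
    intro v _
    split_ifs with hv
    · rw [(hf v hv).1]
    · rfl
  · by_contra hn
    have : g x y = 0 := by
      apply Finset.sum_eq_zero
      intro v _
      split_ifs with hv
      · have : f v x y = 0 := by
          by_contra h0; exact hn ((hf v hv).2.1 x y h0)
        rw [this, mul_zero]
      · rfl
    have h' : g x y = 1 := h
    rw [this] at h'; exact absurd h' (by decide)
  · rw [cnt_cast_eq]
    have e : ∀ y, (if g x y = 1 then (1 : ZMod 2) else 0) = g x y := by
      intro y
      rcases zmod2_cases (g x y) with h | h <;> simp [h]
    simp only [e]
    show ∑ y, ∑ v, _ = _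
    rw [Finset.sum_comm]
    apply Finset.sum_congr rfl
    intro v _
    by_cases hv : L v
    · simp only [hv, if_true]
      rw [← Finset.mul_sum, (hf v hv).2.2]
    · simp [hv]

lemma tjoin (G : SimpleGraph V) (L : V → Prop) [DecidablePred L] (w : V)
    (hw : ∀ v, L v → G.Reachable v w) (t : V → ZMod 2)
    (hs : (∑ v, if L v then t v else 0) = 0) :
    ∃ F : V → V → Prop, (∀ x y, F x y → F y x) ∧ (∀ x y, F x y → G.Adj x y) ∧
      ∀ x, L x → (cnt (F x) : ZMod 2) = t x := by
  obtain ⟨F, h1, h2, h3⟩ := tjoin_gen G L (fun _ => w) hw t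
  refine ⟨F, h1, h2, fun x hx => ?_⟩
  rw [h3]
  have : ∀ v, (if L v then t v * ((if x = v then 1 else 0) + (if x = w then 1 else 0)) else 0)
      = (if x = v then (if L v then t v else 0) else 0)
        + (if L v then t v else 0) * (if x = w then 1 else 0) := by
    intro v; split_ifs <;> ring
  simp only [this]
  rw [Finset.sum_add_distrib, ← Finset.sum_mul, hs]
  simp [hx]

lemma tjoin_root (G : SimpleGraph V) (L : V → Prop) (ρ : V → V)
    (hρ : ∀ v, L v → G.Reachable v (ρ v)) (t : V → ZMod 2) :
    ∃ F : V → V → Prop, (∀ x y, F x y → F y x) ∧ (∀ x y, F x y → G.Adj x y) ∧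
      ∀ x, L x → (∀ v, L v → x ≠ ρ v) → (cnt (F x) : ZMod 2) = t x := by
  classical
  obtain ⟨F, h1, h2, h3⟩ := tjoin_gen G L ρ hρ t
  refine ⟨F, h1, h2, fun x hx hr => ?_⟩
  rw [h3]
  have : ∀ v, (if L v then t v * ((if x = v then 1 else 0) + (if x = ρ v then 1 else 0)) else 0)
      = (if x = v then t x else 0) := by
    intro v
    by_cases hv : L v
    · have := hr v hv
      by_cases hxv : x = v
      · subst hxv; simp [hv, this]
      · simp [hxv, this]
    · have : x ≠ v := by rintro rfl; exact hv hx
      simp [hv, this]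
  simp only [this]
  simp

end tjoin

section star
variable {V : Type*} [Fintype V]

open Classical in
/-- The 2-degree. -/
noncomputable def n2 (A : V → Prop) (m : V → ℕ) (T : V → V → Prop) (v : V) : ℕ :=
  (if A v then m v else 0) + cnt (T v)

open Classical in
/-- The 3-degree. -/
noncomputable def n3 (A : V → Prop) (m : V → ℕ) (T : V → V → Prop) (v : V) : ℕ :=
  (if A v then 0 else m v) + cnt (T v)

/-- Codes allowed for base vertices. -/
def OK (a b : ℕ) : Prop := a = 0 ∨ b = 0 ∨ (a = 1 ∧ Even b)

/-- A good labelling of the vertices in `C`. -/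
structure Good (H : SimpleGraph V) (A : V → Prop) (m : V → ℕ) (C : V → Prop)
    (T2 T3 : V → V → Prop) : Prop where
  symm2 : ∀ u v, T2 u v → T2 v u
  symm3 : ∀ u v, T3 u v → T3 v u
  le2 : ∀ u v, T2 u v → H.Adj u v
  le3 : ∀ u v, T3 u v → H.Adj u v
  disj : ∀ u v, T2 u v → ¬ T3 u v
  ok : ∀ v, C v → OK (n2 A m T2 v) (n3 A m T3 v)
  ne : ∀ u v, C u → C v → A u → ¬ A v → H.Adj u v →
    ¬ (n2 A m T2 u = n2 A m T2 v ∧ n3 A m T3 u = n3 A m T3 v)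

/-- Delete a vertex. -/
def del (H : SimpleGraph V) (r : V) : SimpleGraph V where
  Adj u v := H.Adj u v ∧ u ≠ r ∧ v ≠ r
  symm := ⟨fun _ _ h => ⟨h.1.symm, h.2.2, h.2.1⟩⟩
  loopless := ⟨fun _ h => h.1.ne rfl⟩

def Leaf (H : SimpleGraph V) (r v : V) : Prop := H.Adj r v ∧ ∀ x, H.Adj v x → x = r

structure Star (H : SimpleGraph V) (A : V → Prop) (m : V → ℕ) (r : V) (L : V → Prop) (w : V) :
    Prop where
  bip : ∀ u v, H.Adj u v → (A u ↔ ¬ A v)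
  Ar : A r
  mr : m r = 0
  mL : ∀ v, L v → A v → m v = 0
  Lr : ¬ L r
  Lcl : ∀ v x, L v → H.Adj v x → x ≠ r → L x
  reach : ∀ v, L v → (del H r).Reachable v w
  nonleaf : ∀ v, L v → H.Adj r v → ∃ x, x ≠ r ∧ H.Adj v x
  nbr : ∀ v, H.Adj r v → L v ∨ Leaf H r v
  Lne : (∃ v, L v) → ∃ y, L y ∧ H.Adj r y

/-- Raw data produced by the parity argument. -/
structure Raw (H : SimpleGraph V) (A : V → Prop) (m : V → ℕ) (r : V) (L : V → Prop)
    (α : ZMod 2) (S2 S3 : V → Prop) (T2 T3 : V → V → Prop) : Prop where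
  symm2 : ∀ u v, T2 u v → T2 v u
  symm3 : ∀ u v, T3 u v → T3 v u
  le2 : ∀ u v, T2 u v → H.Adj u v
  le3 : ∀ u v, T3 u v → H.Adj u v
  disj : ∀ u v, T2 u v → ¬ T3 u v
  r2 : cnt (T2 r) = cnt S2
  r3 : cnt (T3 r) = cnt S3
  r3' : ∀ v, T3 r v ↔ S3 v
  s2 : ∀ v, v ≠ r → S2 v → cnt (T2 v) = 1
  s2n : ∀ v, v ≠ r → ¬ S2 v → cnt (T2 v) = 0
  leaf3 : ∀ v, Leaf H r v → S3 v → cnt (T3 v) = 1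
  leaf3n : ∀ v, Leaf H r v → ¬ S3 v → cnt (T3 v) = 0
  LA : ∀ v, L v → A v → (cnt (T3 v) : ZMod 2) = α
  LB2 : ∀ v, L v → ¬ A v → S2 v → ((m v + cnt (T3 v) : ℕ) : ZMod 2) = 0
  LB : ∀ v, L v → ¬ A v → ¬ S2 v → ((m v + cnt (T3 v) : ℕ) : ZMod 2) = 1 + α

open Classical in
lemma raw_exists {H : SimpleGraph V} {A : V → Prop} {m : V → ℕ} {r : V} {L : V → Prop} {w : V}
    (st : Star H A m r L w) (α : ZMod 2) (S2 S3 : V → Prop)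
    (h2 : ∀ v, S2 v → H.Adj r v) (h3 : ∀ v, S3 v → H.Adj r v) (h23 : ∀ v, S2 v → ¬ S3 v)
    (hs : (∑ v, if L v then (if A v then α else if S2 v then (m v : ZMod 2) else
      1 + α + m v + if S3 v then 1 else 0) else 0) = 0) :
    ∃ T2 T3, Raw H A m r L α S2 S3 T2 T3 := by
  obtain ⟨F, f1, f2, f3⟩ := tjoin (del H r) L w st.reach _ hs
  have hS2r : ¬ S2 r := fun h => (h2 r h).ne rfl
  have hS3r : ¬ S3 r := fun h => (h3 r h).ne rfl
  have hFr : ∀ v, ¬ F r v := fun v h => (f2 _ _ h).2.1 rfl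
  have hFr' : ∀ v, ¬ F v r := fun v h => (f2 _ _ h).2.2 rfl
  have hS2A : ∀ v, S2 v → ¬ A v := fun v h => (st.bip _ _ (h2 v h)).1 st.Ar
  have hS3A : ∀ v, S3 v → ¬ A v := fun v h => (st.bip _ _ (h3 v h)).1 st.Ar
  let T2 : V → V → Prop := fun u v => (u = r ∧ S2 v) ∨ (v = r ∧ S2 u)
  let T3 : V → V → Prop := fun u v => F u v ∨ (u = r ∧ S3 v) ∨ (v = r ∧ S3 u)
  have hT3 : ∀ v, v ≠ r → cnt (T3 v) = cnt (F v) + if S3 v then 1 else 0 := by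
    intro v hv
    have : cnt (T3 v) = cnt (fun x => F v x ∨ (S3 v ∧ x = r)) := by
      apply cnt_congr; intro x; simp only [T3]; tauto
    rw [this, cnt_or, cnt_and_const, cnt_eq]
    rintro x hx ⟨_, rfl⟩; exact hFr' v hx
  have hTL : ∀ v, Leaf H r v → ∀ x, ¬ F v x := by
    intro v hv x hx
    exact (f2 _ _ hx).2.2 (hv.2 x (f2 _ _ hx).1)
  refine ⟨T2, T3, ?_⟩
  constructor
  · intro u v h; simp only [T2] at *; tauto
  · intro u v h
    rcases h with h | h | h
    · exact Or.inl (f1 _ _ h)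
    · exact Or.inr (Or.inr h)
    · exact Or.inr (Or.inl h)
  · rintro u v (⟨rfl, h⟩ | ⟨rfl, h⟩)
    · exact h2 v h
    · exact (h2 u h).symm
  · rintro u v (h | ⟨rfl, h⟩ | ⟨rfl, h⟩)
    · exact (f2 _ _ h).1
    · exact h3 v h
    · exact (h3 u h).symm
  · rintro u v (⟨rfl, h⟩ | ⟨rfl, h⟩) (h' | ⟨h', h''⟩ | ⟨h', h''⟩)
    · exact hFr _ h'
    · exact h23 _ h h''
    · subst h'; exact hS2r h
    · exact hFr' _ h'
    · subst h'; exact hS2r h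
    · exact h23 _ h h''
  · apply cnt_congr; intro x; simp only [T2]; tauto
  · apply cnt_congr; intro x; simp only [T3]; have := hFr x; tauto
  · intro x; simp only [T3]; have := hFr x; tauto
  · intro v hv h
    rw [cnt_eq_one]; exact ⟨r, fun x => by simp only [T2]; tauto⟩
  · intro v hv h
    rw [cnt_eq_zero]; intro x; simp only [T2]; tauto
  · intro v hv h
    rw [hT3 v hv.1.ne', cnt_eq_zero.2 (hTL v hv)]; simp [h]
  · intro v hv h
    rw [hT3 v hv.1.ne', cnt_eq_zero.2 (hTL v hv)]; simp [h]
  · intro v hv hA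
    have hvr : v ≠ r := by rintro rfl; exact st.Lr hv
    have : ¬ S3 v := fun h => hS3A v h hA
    rw [hT3 v hvr]; simp [this, f3 v hv, hA]
  · intro v hv hA h
    have hvr : v ≠ r := by rintro rfl; exact st.Lr hv
    rw [hT3 v hvr]; simp [h23 v h, f3 v hv, hA, h, zmod2_add_self]
  · intro v hv hA h
    have hvr : v ≠ r := by rintro rfl; exact st.Lr hv
    rw [hT3 v hvr]; push_cast; rw [f3 v hv]; simp only [hA, h, if_false]
    have e1 := zmod2_add_self (m v : ZMod 2)
    have e2 := zmod2_add_self (if S3 v then (1 : ZMod 2) else 0)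
    linear_combination e1 + e2

lemma even_iff_z (n : ℕ) : Even n ↔ (n : ZMod 2) = 0 := (ZMod.natCast_eq_zero_iff_even).symm

lemma raw_finish {H : SimpleGraph V} {A : V → Prop} {m : V → ℕ} {r : V} {L : V → Prop} {w : V}
    (st : Star H A m r L w) {α : ZMod 2} {S2 S3 : V → Prop} {T2 T3 : V → V → Prop}
    (R : Raw H A m r L α S2 S3 T2 T3) (hS2 : ∀ v, S2 v → H.Adj r v)
    (hleaf : ∀ v, Leaf H r v → S2 v → Even (m v) ∧ ¬ S3 v)
    (hr : (cnt S2 = 0 ∧ (cnt S3 : ZMod 2) = α) ∨ (2 ≤ cnt S2 ∧ cnt S3 = 0) ∨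
      (cnt S2 = 1 ∧ Even (cnt S3) ∧ ∀ v, S2 v → L v → m v + cnt (T3 v) ≠ cnt S3))
    (hl1 : ∀ v, Leaf H r v → S2 v → cnt S2 = 1 → m v ≠ cnt S3)
    (hl2 : ∀ v, Leaf H r v → ¬ S2 v → S3 v → cnt S2 = 0 → m v + 1 ≠ cnt S3)
    (hl3 : ∀ v, Leaf H r v → ¬ S2 v → ¬ S3 v → cnt S2 = 0 → m v ≠ cnt S3) :
    Good H A m (fun v => v = r ∨ L v ∨ Leaf H r v) T2 T3 := by
  have hLr : ∀ v, L v → v ≠ r := by rintro v hv rfl; exact st.Lr hv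
  have e2r : n2 A m T2 r = cnt S2 := by simp [n2, st.Ar, st.mr, R.r2]
  have e3r : n3 A m T3 r = cnt S3 := by simp [n3, st.Ar, R.r3]
  have lA : ∀ v, Leaf H r v → ¬ A v := fun v h => (st.bip _ _ h.1).1 st.Ar
  have hz : (1 : ZMod 2) + α ≠ α := by
    rcases zmod2_cases α with h | h <;> rw [h] <;> decide
  have hS2A : ∀ v, L v → S2 v → ¬ A v := by
    intro v _ h
    exact (st.bip _ _ (hS2 v h)).1 st.Ar
  constructor
  · exact R.symm2
  · exact R.symm3
  · exact R.le2
  · exact R.le3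
  · exact R.disj
  · rintro v (rfl | hv | hv)
    · rw [e2r, e3r]; unfold OK; tauto
    · by_cases hA : A v
      · left
        have : ¬ S2 v := fun h => hS2A v hv h hA
        simp [n2, hA, st.mL v hv hA, R.s2n v (hLr v hv) this]
      · by_cases h : S2 v
        · right; right
          refine ⟨by simp [n2, hA, R.s2 v (hLr v hv) h], ?_⟩
          rw [even_iff_z]; simpa [n3, hA] using R.LB2 v hv hA h
        · left; simp [n2, hA, R.s2n v (hLr v hv) h]
    · have hA := lA v hv
      by_cases h : S2 v
      · right; right
        have := hleaf v hv h
        refine ⟨by simp [n2, hA, R.s2 v hv.1.ne' h], ?_⟩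
        simpa [n3, hA, R.leaf3n v hv this.2] using this.1
      · left; simp [n2, hA, R.s2n v hv.1.ne' h]
  · rintro u v hu hv hAu hAv hadj ⟨q2, q3⟩
    rcases hu with rfl | hu | hu
    · rw [e2r] at q2; rw [e3r] at q3
      rcases hv with rfl | hv | hv
      · exact hAv hAu
      · by_cases h : S2 v
        · have a2 : n2 A m T2 v = 1 := by simp [n2, hAv, R.s2 v (hLr v hv) h]
          rw [a2] at q2
          have a3 : n3 A m T3 v = m v + cnt (T3 v) := by simp [n3, hAv]
          rcases hr with hr | hr | hr
          · omega
          · omega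
          · exact hr.2.2 v h hv (by omega)
        · have a2 : n2 A m T2 v = 0 := by simp [n2, hAv, R.s2n v (hLr v hv) h]
          rw [a2] at q2
          have a3 : n3 A m T3 v = m v + cnt (T3 v) := by simp [n3, hAv]
          rcases hr with hr | hr | hr
          · have := R.LB v hv hAv h
            rw [← a3, ← q3, hr.2] at this
            exact hz this.symm
          · omega
          · omega
      · by_cases h : S2 v
        · have a2 : n2 A m T2 v = 1 := by simp [n2, hAv, R.s2 v hv.1.ne' h]
          have a3 : n3 A m T3 v = m v := by simp [n3, hAv, R.leaf3n v hv (hleaf v hv h).2]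
          exact hl1 v hv h (by omega) (by omega)
        · have a2 : n2 A m T2 v = 0 := by simp [n2, hAv, R.s2n v hv.1.ne' h]
          by_cases h' : S3 v
          · have a3 : n3 A m T3 v = m v + 1 := by simp [n3, hAv, R.leaf3 v hv h']
            exact hl2 v hv h h' (by omega) (by omega)
          · have a3 : n3 A m T3 v = m v := by simp [n3, hAv, R.leaf3n v hv h']
            exact hl3 v hv h h' (by omega) (by omega)
    · have hu2 : ¬ S2 u := fun h => hS2A u hu h hAu
      have a2 : n2 A m T2 u = 0 := by
        simp [n2, hAu, st.mL u hu hAu, R.s2n u (hLr u hu) hu2]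
      have a3 : (n3 A m T3 u : ZMod 2) = α := by simp [n3, hAu, R.LA u hu hAu]
      have hv' : L v := by
        apply st.Lcl u v hu hadj; rintro rfl; exact hAv st.Ar
      have h : ¬ S2 v := by
        intro h
        have : n2 A m T2 v = 1 := by simp [n2, hAv, R.s2 v (hLr v hv') h]
        omega
      have := R.LB v hv' hAv h
      have b3 : n3 A m T3 v = m v + cnt (T3 v) := by simp [n3, hAv]
      rw [← b3, ← q3, a3] at this
      exact hz this.symm
    · exact lA u hu hAu

open Classical in
lemma sum0 {H : SimpleGraph V} {A : V → Prop} {m : V → ℕ} {r : V} {L : V → Prop} {w : V}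
    (st : Star H A m r L w) (S2 S3 : V → Prop)
    (h2 : ∀ v, S2 v → H.Adj r v) (h3 : ∀ v, S3 v → H.Adj r v) (h23 : ∀ v, S2 v → ¬ S3 v) :
    (∑ v, if L v then (if A v then (0 : ZMod 2) else if S2 v then (m v : ZMod 2) else
      1 + 0 + m v + if S3 v then 1 else 0) else 0) =
    (∑ v, if L v then (if A v then (0 : ZMod 2) else 1 + m v) else 0)
      + cnt (fun v => L v ∧ S2 v) + cnt (fun v => L v ∧ S3 v) := by
  have hS2A : ∀ v, S2 v → ¬ A v := fun v h => (st.bip _ _ (h2 v h)).1 st.Ar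
  have hS3A : ∀ v, S3 v → ¬ A v := fun v h => (st.bip _ _ (h3 v h)).1 st.Ar
  rw [cnt_cast_eq, cnt_cast_eq, ← Finset.sum_add_distrib, ← Finset.sum_add_distrib]
  apply Finset.sum_congr rfl
  intro v _
  have q : (1 : ZMod 2) + 1 = 0 := by decide
  by_cases hL : L v
  · by_cases hA : A v
    · have e1 : ¬ S2 v := fun h => hS2A v h hA
      have e2 : ¬ S3 v := fun h => hS3A v h hA
      simp [hL, hA, e1, e2]
    · by_cases e1 : S2 v
      · simp [hL, hA, e1, h23 v e1]; linear_combination -q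
      · simp [hL, hA, e1]
  · simp [hL]

open Classical in
lemma sum1 {H : SimpleGraph V} {A : V → Prop} {m : V → ℕ} {r : V} {L : V → Prop} {w : V}
    (st : Star H A m r L w) (S2 S3 : V → Prop)
    (h2 : ∀ v, S2 v → H.Adj r v) (h3 : ∀ v, S3 v → H.Adj r v) (h23 : ∀ v, S2 v → ¬ S3 v) :
    (∑ v, if L v then (if A v then (1 : ZMod 2) else if S2 v then (m v : ZMod 2) else
      1 + 1 + m v + if S3 v then 1 else 0) else 0) =
    (∑ v, if L v then (if A v then (1 : ZMod 2) else m v) else 0)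
      + cnt (fun v => L v ∧ S3 v) := by
  have hS3A : ∀ v, S3 v → ¬ A v := fun v h => (st.bip _ _ (h3 v h)).1 st.Ar
  rw [cnt_cast_eq, ← Finset.sum_add_distrib]
  apply Finset.sum_congr rfl
  intro v _
  have q : (1 : ZMod 2) + 1 = 0 := by decide
  by_cases hL : L v
  · by_cases hA : A v
    · have e2 : ¬ S3 v := fun h => hS3A v h hA
      simp [hL, hA, e2]
    · by_cases e1 : S2 v
      · simp [hL, hA, e1, h23 v e1]
      · simp only [hL, hA, e1, q, if_true, if_false, true_and]; ring
  · simp [hL]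

lemma lam_nonempty {L : V → Prop} [DecidablePred L] {f : V → ZMod 2}
    (h : (∑ v, if L v then f v else 0) = 1) : ∃ v, L v := by
  by_contra hn
  push Not at hn
  simp [hn] at h

/-- An optional vertex of `L` adjacent to `r` realising a prescribed parity. -/
lemma opt_vertex {H : SimpleGraph V} {A : V → Prop} {m : V → ℕ} {r : V} {L : V → Prop} {w : V}
    (st : Star H A m r L w) [DecidablePred L] (f : V → ZMod 2) :
    ∃ Y : V → Prop, (∀ v, Y v → L v ∧ H.Adj r v) ∧ (∀ u v, Y u → Y v → u = v) ∧
      (∑ v, if L v then f v else 0) + (cnt Y : ZMod 2) = 0 := by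
  rcases zmod2_cases (∑ v, if L v then f v else 0) with h | h
  · refine ⟨fun _ => False, by simp, by simp, ?_⟩
    rw [h, cnt_eq_zero.2 (by simp)]; simp
  · obtain ⟨y, hy⟩ := st.Lne (lam_nonempty h)
    refine ⟨fun v => v = y, by rintro v rfl; exact hy, by rintro u v rfl rfl; rfl, ?_⟩
    rw [h, cnt_eq]; decide

lemma star_good {H : SimpleGraph V} {A : V → Prop} {m : V → ℕ} {r : V} {L : V → Prop} {w : V}
    (st : Star H A m r L w)
    (hK2 : ∀ v, Leaf H r v → (∀ x, H.Adj r x → x = v) → 0 < m v) :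
    ∃ T2 T3, Good H A m (fun v => v = r ∨ L v ∨ Leaf H r v) T2 T3 := by
  classical
  have hLl : ∀ v, L v → ¬ Leaf H r v := by
    rintro v hv ⟨h1, h2⟩
    obtain ⟨x, hx, hx'⟩ := st.nonleaf v hv h1
    exact hx (h2 x hx')
  obtain ⟨Y, hY1, hY2, hY3⟩ := opt_vertex st (fun v => if A v then (0 : ZMod 2) else 1 + m v)
  let E : V → Prop := fun v => Leaf H r v ∧ Even (m v)
  let S : V → Prop := fun v => E v ∨ Y v
  have hS : ∀ v, S v → H.Adj r v := by
    rintro v (h | h)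
    · exact h.1.1
    · exact (hY1 v h).2
  have hSL : cnt (fun v => L v ∧ S v) = cnt Y := by
    apply cnt_congr; intro x
    constructor
    · rintro ⟨h1, h2 | h2⟩
      · exact absurd h2.1 (hLl x h1)
      · exact h2
    · intro h; exact ⟨(hY1 x h).1, Or.inr h⟩
  have hF : cnt (fun _ : V => False) = 0 := cnt_eq_zero.2 (by simp)
  have hLF : cnt (fun v : V => L v ∧ False) = 0 := cnt_eq_zero.2 (by simp)
  obtain ⟨T2, T3, R⟩ := raw_exists st 0 S (fun _ => False) hS (by simp) (by simp) (by
    rw [sum0 st S _ hS (by simp) (by simp), hSL, hLF, hY3]; simp)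
  have hlS : ∀ v, Leaf H r v → S v → Even (m v) := by
    rintro v hv (h | h)
    · exact h.2
    · exact absurd hv (hLl v (hY1 v h).1)
  by_cases c2 : 2 ≤ cnt S
  · refine ⟨T2, T3, raw_finish st R hS ?_ ?_ ?_ ?_ ?_⟩
    · intro v hv h; exact ⟨hlS v hv h, id⟩
    · right; left; exact ⟨c2, hF⟩
    · intros; omega
    · intros; omega
    · intros; omega
  by_cases c0 : cnt S = 0
  · refine ⟨T2, T3, raw_finish st R hS ?_ ?_ ?_ ?_ ?_⟩
    · intro v hv h; exact absurd h (cnt_eq_zero.1 c0 v)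
    · left; exact ⟨c0, by rw [hF]; simp⟩
    · intros; omega
    · intro v _ _ h; exact h.elim
    · intro v hv h _ _ h'
      rw [hF] at h'
      exact h (Or.inl ⟨hv, by rw [h']; exact Even.zero⟩)
  have c1 : cnt S = 1 := by omega
  obtain ⟨y, hy⟩ := cnt_eq_one.1 c1
  have hyS : S y := (hy y).2 rfl
  rcases hyS with hyE | hyY
  · -- the only vertex of S is an even leaf
    have hYF : ∀ v, ¬ Y v := by
      intro v hv
      have := (hy v).1 (Or.inr hv); subst this
      exact hLl v (hY1 v hv).1 hyE.1
    by_cases hm : m y = 0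
    swap
    · refine ⟨T2, T3, raw_finish st R hS ?_ ?_ ?_ ?_ ?_⟩
      · intro v hv h; exact ⟨hlS v hv h, id⟩
      · right; right
        refine ⟨c1, by rw [hF]; simp, fun v hv hL => ?_⟩
        rw [(hy v).1 hv] at hL
        exact absurd hyE.1 (hLl y hL)
      · intro v _ hv _; rw [(hy v).1 hv, hF]; exact hm
      · intros; omega
      · intros; omega
    obtain ⟨Y', hY1', hY2', hY3'⟩ := opt_vertex st (fun v => if A v then (1 : ZMod 2) else m v)
    let S3 : V → Prop := fun v => (Leaf H r v ∧ ¬ Even (m v)) ∨ Y' v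
    have hS3 : ∀ v, S3 v → H.Adj r v := by
      rintro v (h | h)
      · exact h.1.1
      · exact (hY1' v h).2
    have hSL3 : cnt (fun v => L v ∧ S3 v) = cnt Y' := by
      apply cnt_congr; intro x
      constructor
      · rintro ⟨h1, h2 | h2⟩
        · exact absurd h2.1 (hLl x h1)
        · exact h2
      · intro h; exact ⟨(hY1' x h).1, Or.inr h⟩
    have hEy : ∀ v, Leaf H r v → ¬ S3 v → v = y := by
      intro v hv h
      apply (hy v).1
      left
      refine ⟨hv, ?_⟩
      by_contra hn
      exact h (Or.inl ⟨hv, hn⟩)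
    have hyS3 : ¬ S3 y := by
      rintro (h | h)
      · exact h.2 hyE.2
      · exact hLl y (hY1' y h).1 hyE.1
    have hl3odd : ∀ v, Leaf H r v → S3 v → ¬ Even (m v) := by
      rintro v hv (h | h)
      · exact h.2
      · exact absurd hv (hLl v (hY1' v h).1)
    rcases Nat.even_or_odd (cnt S3) with he | ho
    swap
    · obtain ⟨T2, T3, R⟩ := raw_exists st 1 (fun _ => False) S3 (by simp) hS3 (by simp) (by
        rw [sum1 st _ S3 (by simp) hS3 (by simp), hSL3, hY3'])
      refine ⟨T2, T3, raw_finish st R (by simp) ?_ ?_ ?_ ?_ ?_⟩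
      · intro v hv h; exact h.elim
      · left; refine ⟨hF, ?_⟩
        exact (ZMod.natCast_eq_one_iff_odd).2 ho
      · intro v _ h; exact h.elim
      · intro v hv _ h _ h'
        have := hl3odd v hv h
        rw [← h'] at ho
        rw [Nat.not_even_iff_odd] at this
        exact absurd ho (Nat.not_odd_iff_even.2 this.add_one)
      · intro v hv _ h _ h'
        rw [hEy v hv h, hm] at h'
        rw [← h'] at ho; simp at ho
    by_cases h0 : cnt S3 = 0
    · have h0' := cnt_eq_zero.1 h0
      have hY'0 : cnt Y' = 0 := cnt_eq_zero.2 fun v hv => h0' v (Or.inr hv)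
      obtain ⟨T2, T3, R⟩ := raw_exists st 1 (H.Adj r) (fun _ => False) (by simp) (by simp) (by simp)
        (by
          rw [sum1 st _ _ (by simp) (by simp) (by simp), hLF]
          rw [hY'0] at hY3'; exact hY3')
      refine ⟨T2, T3, raw_finish st R (by simp) ?_ ?_ ?_ ?_ ?_⟩
      · intro v hv h; rw [hEy v hv (h0' v), hm]; simp
      · right; left
        refine ⟨?_, hF⟩
        rw [two_le_cnt]
        by_contra hn
        push Not at hn
        have := hK2 y hyE.1 (fun x hx => by
          by_contra hxy
          exact hn x y hxy hx hyE.1.1)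
        omega
      · intro v hv _ h1 _
        have := hK2 y hyE.1 (fun x hx => by
          obtain ⟨a, ha⟩ := cnt_eq_one.1 h1
          rw [(ha x).1 hx, (ha y).1 hyE.1.1])
        omega
      · intro v hv h; exact absurd hv.1 h
      · intro v hv h; exact absurd hv.1 h
    · have h11 : cnt (fun v => v = y) = 1 := cnt_eq y
      obtain ⟨T2, T3, R⟩ := raw_exists st 1 (fun v => v = y) S3 (by rintro v rfl; exact hyE.1.1) hS3
        (by rintro v rfl; exact hyS3) (by
          rw [sum1 st _ S3 (by rintro v rfl; exact hyE.1.1) hS3 (by rintro v rfl; exact hyS3),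
            hSL3, hY3'])
      refine ⟨T2, T3, raw_finish st R (by rintro v rfl; exact hyE.1.1) ?_ ?_ ?_ ?_ ?_⟩
      · rintro v hv rfl; exact ⟨hyE.2, hyS3⟩
      · right; right
        refine ⟨h11, he, ?_⟩
        rintro v rfl hL; exact absurd hyE.1 (hLl v hL)
      · rintro v hv rfl _ h; omega
      · intros; omega
      · intros; omega
  · -- the only vertex of S lies in L
    have hyL := (hY1 y hyY).1
    have hyr := (hY1 y hyY).2
    have hyA : ¬ A y := (st.bip _ _ hyr).1 st.Ar
    have hlo : ∀ v, Leaf H r v → ¬ Even (m v) := by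
      intro v hv h
      have := (hy v).1 (Or.inl ⟨hv, h⟩)
      subst this; exact hLl v hyL hv
    by_cases hz : m y + cnt (T3 y) = 0
    swap
    · refine ⟨T2, T3, raw_finish st R hS ?_ ?_ ?_ ?_ ?_⟩
      · intro v hv h; exact ⟨hlS v hv h, id⟩
      · right; right
        refine ⟨c1, by rw [hF]; simp, fun v hv hL => ?_⟩
        rw [(hy v).1 hv, hF]; exact hz
      · intro v hv h; exact absurd (hlS v hv h) (hlo v hv)
      · intros; omega
      · intros; omega
    have hmy : m y = 0 := by omega
    have hTy : cnt (T3 y) = 0 := by omega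
    have hTy' := cnt_eq_zero.1 hTy
    have hLr : ∀ v, L v → v ≠ r := by rintro v hv rfl; exact st.Lr hv
    let T2' : V → V → Prop := fun u v => H.Adj u v ∧ (u = y ∨ v = y)
    have ty : 2 ≤ cnt (T2' y) := by
      rw [two_le_cnt]
      obtain ⟨x, hx, hx'⟩ := st.nonleaf y hyL hyr
      exact ⟨x, r, hx, ⟨hx', Or.inl rfl⟩, ⟨hyr.symm, Or.inl rfl⟩⟩
    have tA : ∀ v, H.Adj v y → cnt (T2' v) = 1 := by
      intro v hv
      rw [cnt_eq_one]
      refine ⟨y, fun x => ⟨?_, ?_⟩⟩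
      · rintro ⟨h1, rfl | h1⟩
        · exact absurd rfl hv.ne
        · exact h1
      · rintro rfl; exact ⟨hv, Or.inr rfl⟩
    have t0 : ∀ v, v ≠ y → ¬ H.Adj v y → cnt (T2' v) = 0 := by
      intro v hvy hv
      rw [cnt_eq_zero]
      rintro x ⟨h1, rfl | rfl⟩
      · exact hvy rfl
      · exact hv h1
    have nA : ∀ v, (v = r ∨ L v ∨ Leaf H r v) → A v → m v = 0 ∧ Even (cnt (T3 v)) := by
      rintro v (rfl | h | h) hA
      · refine ⟨st.mr, ?_⟩; rw [R.r3, hF]; simp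
      · refine ⟨st.mL v h hA, ?_⟩; rw [even_iff_z]; exact R.LA v h hA
      · exact absurd hA ((st.bip _ _ h.1).1 st.Ar)
    have nB : ∀ v, (v = r ∨ L v ∨ Leaf H r v) → ¬ A v → v ≠ y → ¬ Even (m v + cnt (T3 v)) := by
      rintro v (rfl | h | h) hA hvy
      · exact absurd st.Ar hA
      · rw [even_iff_z, R.LB v h hA (fun h => hvy ((hy v).1 h))]; decide
      · rw [R.leaf3n v h id]; exact hlo v h
    have nadj : ∀ v, ¬ A v → ¬ H.Adj v y := fun v hv h => hyA (by
      by_contra h'; exact hv ((st.bip _ _ h).2 h'))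
    refine ⟨T2', T3, ?_⟩
    constructor
    · rintro u v ⟨h1, h2⟩; exact ⟨h1.symm, h2.symm⟩
    · exact R.symm3
    · exact fun u v h => h.1
    · exact R.le3
    · rintro u v ⟨h1, rfl | rfl⟩ h
      · exact hTy' _ h
      · exact hTy' _ (R.symm3 _ _ h)
    · intro v hv
      by_cases hA : A v
      · obtain ⟨e1, e2⟩ := nA v hv hA
        by_cases h : H.Adj v y
        · right; right; simp [n2, n3, hA, e1, e2, tA v h]
        · left
          have : v ≠ y := by rintro rfl; exact hyA hA
          simp [n2, hA, e1, t0 v this h]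
      · by_cases hvy : v = y
        · right; left; subst hvy; simp [n3, hA, hmy, hTy]
        · left; simp [n2, hA, t0 v hvy (nadj v hA)]
    · rintro u v hu hv hAu hAv hadj ⟨q2, q3⟩
      obtain ⟨e1, e2⟩ := nA u hu hAu
      by_cases hvy : v = y
      · subst hvy
        simp [n2, hAu, hAv, e1, tA u hadj] at q2
        omega
      · have := nB v hv hAv hvy
        simp [n3, hAu, hAv] at q3
        rw [← q3] at this; exact this e2

end star

section comp
variable {V : Type*} [Fintype V]

lemma reach_closed {H : SimpleGraph V} {S : V → Prop} (hcl : ∀ x y, S x → H.Adj x y → S y)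
    {u v : V} (h : H.Reachable u v) (hu : S u) : S v := by
  obtain ⟨p⟩ := h
  induction p with
  | nil => exact hu
  | cons h p ih => exact ih (hcl _ _ hu h)

lemma reach_step {H : SimpleGraph V} {u v : V} (h : H.Reachable u v) (hne : u ≠ v) :
    ∃ x, H.Adj u x ∧ H.Reachable x v ∧ H.dist u v = H.dist x v + 1 := by
  obtain ⟨p, hp⟩ := h.exists_walk_length_eq_dist
  cases p with
  | nil => exact absurd rfl hne
  | cons h q =>
    rename_i x
    refine ⟨x, h, ⟨q⟩, ?_⟩
    have h1 : H.dist x v ≤ q.length := SimpleGraph.dist_le q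
    obtain ⟨q', hq'⟩ := (show H.Reachable x v from ⟨q⟩).exists_walk_length_eq_dist
    have h2 : H.dist u v ≤ _ := SimpleGraph.dist_le (SimpleGraph.Walk.cons h q')
    simp at hp h2
    omega

lemma comp_good {H : SimpleGraph V} {A : V → Prop} {m : V → ℕ}
    (bip : ∀ u v, H.Adj u v → (A u ↔ ¬ A v)) (w0 : V)
    (hm : ∀ v, H.Reachable v w0 → A v → m v = 0)
    (hK2 : ∀ u v, H.Adj u v → (∀ x, H.Adj u x → x = v) → (∀ x, H.Adj v x → x = u) →
      0 < m u ∨ 0 < m v) :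
    ∃ T2 T3, Good H A m (fun v => H.Reachable v w0) T2 T3 := by
  classical
  by_cases hex : ∃ w, A w ∧ H.Reachable w w0
  swap
  · push Not at hex
    refine ⟨fun _ _ => False, fun _ _ => False, by simp, by simp, by simp, by simp, by simp, ?_, ?_⟩
    · intro v hv
      have : ¬ A v := fun h => hex v h hv
      left; simp [n2, this, cnt_eq_zero]
    · intro u v hu _ hA
      exact absurd hu (hex u hA)
  obtain ⟨w, hAw, hw⟩ := hex
  obtain ⟨r, hr, hmax⟩ := Finset.exists_max_image
    (Finset.univ.filter fun v => A v ∧ H.Reachable v w) (fun v => H.dist v w)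
    ⟨w, by simp [hAw]⟩
  simp only [Finset.mem_filter, Finset.mem_univ, true_and, and_imp] at hr hmax
  obtain ⟨hAr, hrw⟩ := hr
  have key1 : ∀ n z, H.dist z w = n → H.Reachable z w → z ≠ r → n ≤ H.dist r w →
      (del H r).Reachable z w := by
    intro n
    induction n with
    | zero =>
      intro z h1 h2 _ _
      rw [h2.dist_eq_zero_iff] at h1
      rw [h1]
    | succ n ih =>
      intro z h1 h2 h3 h4
      have hzw : z ≠ w := by rintro rfl; simp at h1
      obtain ⟨x, hx1, hx2, hx3⟩ := reach_step h2 hzw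
      have hxr : x ≠ r := by rintro rfl; omega
      have := ih x (by omega) hx2 hxr (by omega)
      exact SimpleGraph.Reachable.trans
        (SimpleGraph.Adj.reachable (show (del H r).Adj z x from ⟨hx1, h3, hxr⟩)) this
  have keyA : ∀ z, A z → H.Reachable z w → z ≠ r → (del H r).Reachable z w := fun z h1 h2 h3 =>
    key1 _ z rfl h2 h3 (hmax z h1 h2)
  have st : Star H A m r (fun z => H.Reachable z w ∧ z ≠ r ∧ ¬ Leaf H r z) w := by
    constructor
    · exact bip
    · exact hAr
    · exact hm r (hrw.trans hw) hAr
    · intro v hv hA; exact hm v (hv.1.trans hw) hA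
    · intro h; exact h.2.1 rfl
    · intro v x hv hvx hxr
      refine ⟨hvx.symm.reachable.trans hv.1, hxr, ?_⟩
      intro hl
      exact hv.2.1 (hl.2 v hvx.symm)
    · rintro v ⟨h1, h2, h3⟩
      by_cases hA : A v
      · exact keyA v hA h1 h2
      · have : ∃ x, H.Adj v x ∧ x ≠ r := by
          by_cases hadj : H.Adj r v
          · by_contra hn
            push Not at hn
            exact h3 ⟨hadj, hn⟩
          · have hvw : v ≠ w := by rintro rfl; exact hA hAw
            obtain ⟨x, hx, _⟩ := reach_step h1 hvw
            exact ⟨x, hx, by rintro rfl; exact hadj hx.symm⟩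
        obtain ⟨x, hx, hxr⟩ := this
        have hAx : A x := (bip _ _ hx.symm).2 hA
        exact SimpleGraph.Reachable.trans
          (SimpleGraph.Adj.reachable (show (del H r).Adj v x from ⟨hx, h2, hxr⟩))
          (keyA x hAx (hx.symm.reachable.trans h1) hxr)
    · rintro v ⟨h1, h2, h3⟩ hadj
      by_contra hn
      push Not at hn
      exact h3 ⟨hadj, fun x hx => by_contra fun h => hn x h hx⟩
    · intro v hv
      by_cases h : Leaf H r v
      · exact Or.inr h
      · exact Or.inl ⟨hv.symm.reachable.trans hrw, hv.ne', h⟩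
    · rintro ⟨v, h1, h2, h3⟩
      by_contra hn
      push Not at hn
      have : v = r ∨ Leaf H r v := by
        refine reach_closed (S := fun v => v = r ∨ Leaf H r v) ?_ (hrw.trans h1.symm) (Or.inl rfl)
        rintro x y (rfl | hx) hxy
        · right
          by_contra hl
          exact hn y ⟨hxy.symm.reachable.trans hrw, hxy.ne', hl⟩ hxy
        · left; exact hx.2 y hxy
      tauto
  obtain ⟨T2, T3, g⟩ := star_good st (by
    intro v hl hx
    have := hK2 r v hl.1 hx hl.2
    rcases this with h | h
    · rw [st.mr] at h; omega
    · exact h)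
  refine ⟨T2, T3, ?_⟩
  convert g using 2 with v

  constructor
  · intro h
    have := h.trans hw.symm
    tauto
  · rintro (rfl | h | h)
    · exact hrw.trans hw
    · exact h.1.trans hw
    · exact h.1.symm.reachable.trans (hrw.trans hw)

end comp

section cover
variable {V : Type*} [Fintype V]

lemma cover (E : V → V → Prop) (a : V → ℕ) (ha : ∀ v u, E v u → 1 ≤ a u) :
    ∃ T : V → V → Prop, (∀ v u, T v u → E v u) ∧ ∀ v, (∃ u, E v u) →
      (cnt (T v) = 1 ∧ ∀ u, E v u → 2 ≤ a u + cnt (fun x => T x u)) ∨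
      (2 ≤ cnt (T v) ∧ ∀ u, E v u → Even (a u + cnt (fun x => T x u))) := by
  classical
  let Cov : Finset (V × V) → Prop := fun F => (∀ p ∈ F, E p.1 p.2) ∧
    (∀ v, (∃ u, E v u) → ∃ u, (v, u) ∈ F) ∧
    (∀ u, a u = 1 → (∃ v, E v u) → ∃ v, (v, u) ∈ F)
  obtain ⟨F, hF, hmin⟩ := Finset.exists_min_image (Finset.univ.filter Cov) Finset.card
    ⟨Finset.univ.filter (fun p => E p.1 p.2), by
      simp only [Cov, Finset.mem_filter, Finset.mem_univ, true_and]
      exact ⟨fun p h => h, fun v h => h, fun u _ h => h⟩⟩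
  simp only [Finset.mem_filter, Finset.mem_univ, true_and] at hF hmin
  obtain ⟨hF1, hF2, hF3⟩ := hF
  have hm : ∀ v u, (v, u) ∈ F → (∀ u', (v, u') ∈ F → u' = u) ∨
      (a u = 1 ∧ ∀ v', (v', u) ∈ F → v' = v) := by
    intro v u h
    by_contra hn
    push Not at hn
    obtain ⟨⟨u', hu', hne⟩, h2⟩ := hn
    have : Cov (F.erase (v, u)) := by
      refine ⟨fun p hp => hF1 p (Finset.mem_of_mem_erase hp), ?_, ?_⟩
      · intro x hx
        obtain ⟨y, hy⟩ := hF2 x hx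
        by_cases hxv : x = v
        · subst hxv
          exact ⟨u', by simp [hne, hu']⟩
        · exact ⟨y, by simp [hxv, hy]⟩
      · intro y hy hx
        obtain ⟨x, hxy⟩ := hF3 y hy hx
        by_cases hyu : y = u
        · subst hyu
          obtain ⟨v', h3, h4⟩ := h2 hy
          exact ⟨v', by simp [h3, h4]⟩
        · exact ⟨x, by simp [hyu, hxy]⟩
    have h5 := hmin _ this
    have h6 := Finset.card_erase_lt_of_mem h
    omega
  let P : V → Prop := fun v => 2 ≤ cnt (fun u => (v, u) ∈ F)
  let q : V → Prop := fun u => Odd (a u + cnt (fun v => (v, u) ∈ F)) ∧ ∃ v, P v ∧ E v u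
  have hp : ∀ u, ∃ v, q u → P v ∧ E v u := by
    intro u
    by_cases h : q u
    · obtain ⟨v, hv⟩ := h.2; exact ⟨v, fun _ => hv⟩
    · exact ⟨u, fun h' => absurd h' h⟩
  choose p hp using hp
  have hpF : ∀ u, q u → (p u, u) ∉ F := by
    intro u hq hmem
    obtain ⟨hP, hE⟩ := hp u hq
    have h1 : a u = 1 ∧ ∀ v', (v', u) ∈ F → v' = p u := by
      rcases hm _ _ hmem with h | h
      · obtain ⟨x, y, hxy, hx, hy⟩ := two_le_cnt.1 hP
        exact absurd ((h x hx).trans (h y hy).symm) hxy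
      · exact h
    have h2 : cnt (fun v => (v, u) ∈ F) = 1 := by
      rw [cnt_eq_one]
      exact ⟨p u, fun x => ⟨h1.2 x, by rintro rfl; exact hmem⟩⟩
    have := hq.1
    rw [h1.1, h2] at this
    exact absurd this (by decide)
  have hcnt : ∀ u, cnt (fun x => (x, u) ∈ F ∨ (q u ∧ x = p u)) =
      cnt (fun x => (x, u) ∈ F) + if q u then 1 else 0 := by
    intro u
    rw [cnt_or, cnt_and_const, cnt_eq]
    rintro x hx ⟨h, rfl⟩
    exact hpF u h hx
  refine ⟨fun v u => (v, u) ∈ F ∨ (q u ∧ v = p u), ?_, ?_⟩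
  · rintro v u (h | ⟨h, rfl⟩)
    · exact hF1 _ h
    · exact (hp u h).2
  · intro v hv
    simp only [hcnt]
    by_cases hP : P v
    · right
      refine ⟨le_trans hP (cnt_mono fun x hx => Or.inl hx), ?_⟩
      intro u hu
      by_cases ho : Odd (a u + cnt (fun v => (v, u) ∈ F))
      · have hq : q u := ⟨ho, v, hP, hu⟩
        rw [if_pos hq, ← add_assoc]
        exact ho.add_one
      · have hq : ¬ q u := fun h => ho h.1
        rw [if_neg hq]
        simpa using ho
    · left
      have h1 : 0 < cnt (fun u => (v, u) ∈ F) := cnt_pos.2 (hF2 v hv)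
      have h2 : cnt (fun u => (v, u) ∈ F ∨ (q u ∧ v = p u)) = cnt (fun u => (v, u) ∈ F) := by
        apply cnt_congr
        intro u
        constructor
        · rintro (h | ⟨h, rfl⟩)
          · exact h
          · exact absurd (hp u h).1 hP
        · exact Or.inl
      refine ⟨by rw [h2]; simp only [P] at hP; omega, ?_⟩
      intro u hu
      have := ha v u hu
      by_cases h : a u = 1
      · have : 0 < cnt (fun v => (v, u) ∈ F) := cnt_pos.2 (hF3 u h ⟨v, hu⟩)
        omega
      · omega

end cover

section plus
variable {V : Type*} [Fintype V]

/-- Delete a set of vertices. -/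
def dels (H : SimpleGraph V) (U : V → Prop) : SimpleGraph V where
  Adj u v := H.Adj u v ∧ ¬ U u ∧ ¬ U v
  symm := ⟨fun _ _ h => ⟨h.1.symm, h.2.2, h.2.1⟩⟩
  loopless := ⟨fun _ h => h.1.ne rfl⟩

lemma plus_root {H : SimpleGraph V} {A U : V → Prop}
    (bip : ∀ u v, H.Adj u v → (A u ↔ ¬ A v)) (hU : ∀ u, U u → A u) {u v : V}
    (h : H.Reachable v u) (hu : U u) (hv : ¬ U v) :
    ∃ b, (¬ A b ∧ ∃ g, U g ∧ H.Adj b g) ∧ (dels H U).Reachable v b := by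
  obtain ⟨p⟩ := h
  induction p with
  | nil => exact absurd hu hv
  | cons h p ih =>
    rename_i x y z
    by_cases hy : U y
    · exact ⟨x, ⟨(bip _ _ h.symm).1 (hU y hy), y, hy, h⟩, SimpleGraph.Reachable.refl _⟩
    · obtain ⟨b, hb, hr⟩ := ih hu hy
      exact ⟨b, hb, SimpleGraph.Reachable.trans
        (SimpleGraph.Adj.reachable (show (dels H U).Adj x y from ⟨h, hv, hy⟩)) hr⟩

set_option maxHeartbeats 400000 in
lemma plus_good {H : SimpleGraph V} {A : V → Prop} {m : V → ℕ}
    (bip : ∀ u v, H.Adj u v → (A u ↔ ¬ A v)) :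
    ∃ T2 T3, Good H A m (fun v => ∃ u, (A u ∧ 0 < m u) ∧ H.Reachable v u) T2 T3 := by
  classical
  obtain ⟨U, hUdef⟩ : ∃ U : V → Prop, ∀ u, U u ↔ (A u ∧ 0 < m u) := ⟨_, fun u => Iff.rfl⟩
  have hUA : ∀ u, U u → A u := fun u h => ((hUdef u).1 h).1
  simp only [← hUdef]
  set P : V → Prop := fun v => ∃ u, U u ∧ H.Reachable v u with hP
  set H' := dels H U with hH'
  let Q : V → Prop := fun b => ¬ A b ∧ ∃ g, U g ∧ H.Adj b g
  -- roots
  have hroot : ∀ C : H'.ConnectedComponent, ∃ b, (∃ b', Q b' ∧ H'.connectedComponentMk b' = C) →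
      Q b ∧ H'.connectedComponentMk b = C := by
    intro C
    by_cases h : ∃ b', Q b' ∧ H'.connectedComponentMk b' = C
    · obtain ⟨b, hb⟩ := h; exact ⟨b, fun _ => hb⟩
    · obtain ⟨v, rfl⟩ := C.exists_rep
      exact ⟨v, fun h' => absurd h' h⟩
  choose root hroot using hroot
  obtain ⟨ρ, hρ⟩ : ∃ ρ : V → V, ∀ v, ρ v = root (H'.connectedComponentMk v) :=
    ⟨_, fun v => rfl⟩
  let L : V → Prop := fun v => P v ∧ ¬ U v
  have hρL : ∀ v, L v → Q (ρ v) ∧ H'.Reachable v (ρ v) := by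
    rintro v ⟨⟨u, hu, hr⟩, hv⟩
    obtain ⟨b, hb, hbr⟩ := plus_root bip hUA hr hu hv
    have := hroot (H'.connectedComponentMk v)
      ⟨b, hb, (SimpleGraph.ConnectedComponent.eq.2 hbr).symm⟩
    rw [hρ]
    exact ⟨this.1, (SimpleGraph.ConnectedComponent.eq.1 this.2).symm⟩
  have hρc : ∀ u v, H'.Reachable u v → ρ u = ρ v := by
    intro u v h
    rw [hρ, hρ, SimpleGraph.ConnectedComponent.eq.2 h]
  have hPadj : ∀ u v, H.Adj u v → P u → P v := by
    rintro u v h ⟨x, hx, hr⟩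
    exact ⟨x, hx, h.symm.reachable.trans hr⟩
  obtain ⟨F, F1, F2, F3⟩ := tjoin_root H' L ρ (fun v hv => (hρL v hv).2)
    (fun v => if A v then 0 else 1 + (m v : ZMod 2))
  have F3' : ∀ x, L x → ρ x ≠ x → (cnt (F x) : ZMod 2) = if A x then 0 else 1 + (m x : ZMod 2) := by
    intro x hx hne
    apply F3 x hx
    rintro v hv rfl
    exact hne (hρc _ _ (hρL v hv).2).symm
  have FU : ∀ u, U u → cnt (F u) = 0 := by
    intro u hu
    rw [cnt_eq_zero]
    intro x hx
    exact (F2 _ _ hx).2.1 hu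
  have FA : ∀ x, L x → A x → Even (cnt (F x)) := by
    intro x hx hA
    rw [even_iff_z, F3' x hx, if_pos hA]
    intro h
    have := (hρL x hx).1.1
    rw [h] at this; exact this hA
  have FB : ∀ x, L x → ¬ A x → ρ x ≠ x → ¬ Even (m x + cnt (F x)) := by
    intro x hx hA hne
    rw [even_iff_z]; push_cast
    rw [F3' x hx hne, if_neg hA]
    have := zmod2_add_self (m x : ZMod 2)
    intro h
    have : (1 : ZMod 2) = 0 := by linear_combination h - this
    exact absurd this (by decide)
  let R : V → Prop := fun v => L v ∧ ρ v = v ∧ Even (m v + cnt (F v)) ∧ ∃ x, H'.Adj v x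
  let R1 : V → Prop := fun v => R v ∧ 0 < m v + cnt (F v)
  let R0 : V → Prop := fun v => R v ∧ m v + cnt (F v) = 0
  have hRB : ∀ v, R v → ¬ A v := by
    intro v hv
    have := (hρL v hv.1).1.1
    rwa [hv.2.1] at this
  have hg : ∀ v, ∃ g, R v → U g ∧ H.Adj v g := by
    intro v
    by_cases h : R v
    · have := (hρL v h.1).1.2
      rw [h.2.1] at this
      obtain ⟨g, hg⟩ := this
      exact ⟨g, fun _ => hg⟩
    · exact ⟨v, fun h' => absurd h' h⟩
  choose g hg using hg
  have hx : ∀ v, ∃ x, R v → H'.Adj v x := by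
    intro v
    by_cases h : R v
    · obtain ⟨x, hx⟩ := h.2.2.2
      exact ⟨x, fun _ => hx⟩
    · exact ⟨v, fun h' => absurd h' h⟩
  choose x hx using hx
  let a : V → ℕ := fun u => m u + cnt (fun v => R1 v ∧ g v = u)
  obtain ⟨T, T1, T2⟩ := cover (fun v u => R0 v ∧ U u ∧ H.Adj v u) a (by
    rintro v u ⟨_, h, _⟩
    have := ((hUdef u).1 h).2
    simp only [a]; omega)
  let X : V → Prop := fun v => R0 v ∧ 2 ≤ cnt (T v) ∧ Even (cnt (T v))
  let D : V → V → Prop := fun v u => (R1 v ∧ g v = u) ∨ T v u ∨ (X v ∧ u = x v)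
  have hDR : ∀ v u, D v u → R v := by
    rintro v u (h | h | h)
    · exact h.1.1
    · exact (T1 _ _ h).1.1
    · exact h.1.1.1
  have hDH : ∀ v u, D v u → H.Adj v u := by
    rintro v u (⟨h, rfl⟩ | h | ⟨h, rfl⟩)
    · exact (hg v h.1).2
    · exact (T1 _ _ h).2.2
    · exact (hx v h.1.1).1
  have hDA : ∀ v u, D v u → A u := by
    intro v u h
    exact (bip _ _ (hDH v u h).symm).2 (hRB v (hDR v u h))
  have cB : ∀ v, ¬ A v → cnt (fun u => D v u ∨ D u v) = cnt (D v) := by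
    intro v hv
    apply cnt_congr
    intro u
    constructor
    · rintro (h | h)
      · exact h
      · exact absurd (hDA _ _ h) hv
    · exact Or.inl
  have cA : ∀ u, A u → cnt (fun v => D u v ∨ D v u) = cnt (fun v => D v u) := by
    intro v hv
    apply cnt_congr
    intro u
    constructor
    · rintro (h | h)
      · exact absurd hv (hRB _ (hDR _ _ h))
      · exact h
    · exact Or.inr
  have cU : ∀ u, U u → n2 A m (fun u v => D u v ∨ D v u) u = a u + cnt (fun v => T v u) := by
    intro u hu
    have hA := hUA u hu
    simp only [n2, if_pos hA, cA u hA, a]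
    rw [add_assoc, ← cnt_or]
    · congr 1
      apply cnt_congr
      intro v
      simp only [D]
      constructor
      · rintro (h | h | ⟨h, rfl⟩)
        · exact Or.inl h
        · exact Or.inr h
        · exact absurd hu (hx v h.1.1).2.2
      · rintro (h | h)
        · exact Or.inl h
        · exact Or.inr (Or.inl h)
    · rintro v ⟨h, _⟩ h'
      have h1 := h.2
      have h2 := (T1 _ _ h').1.2
      omega
  have dA : ∀ u v, A u → ¬ U u → D v u → X v ∧ v = ρ u := by
    rintro u v hA hu (⟨h, rfl⟩ | h | ⟨h, rfl⟩)
    · exact absurd (hg v h.1).1 hu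
    · exact absurd (T1 _ _ h).2.1 hu
    · refine ⟨h, ?_⟩
      rw [hρc (x v) v (hx v h.1.1).symm.reachable]
      exact h.1.1.2.1.symm
  have nA : ∀ u, A u → ¬ U u → n2 A m (fun u v => D u v ∨ D v u) u = cnt (fun v => D v u) := by
    intro u hA hu
    have hm : m u = 0 := by
      by_contra h
      exact hu ((hUdef u).2 ⟨hA, by omega⟩)
    simp [n2, hA, cA u hA, hm]
  have nA1 : ∀ u, A u → ¬ U u → cnt (fun v => D v u) ≤ 1 := by
    intro u hA hu
    rw [← cnt_eq (ρ u)]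
    exact cnt_mono fun v h => (dA u v hA hu h).2
  have nB : ∀ v, ¬ A v → n2 A m (fun u v => D u v ∨ D v u) v = cnt (D v) := by
    intro v hA
    simp [n2, hA, cB v hA]
  have nBn : ∀ v, ¬ R v → cnt (D v) = 0 := by
    intro v h
    rw [cnt_eq_zero]
    exact fun u hu => h (hDR _ _ hu)
  have nB1 : ∀ v, R1 v → cnt (D v) = 1 := by
    intro v h
    rw [cnt_eq_one]
    refine ⟨g v, fun u => ?_⟩
    have hn : ¬ R0 v := fun h' => by have h1 := h.2; have h2 := h'.2; omega
    constructor
    · rintro (h | h | h)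
      · exact h.2.symm
      · exact absurd (T1 _ _ h).1 hn
      · exact absurd h.1.1 hn
    · rintro rfl; exact Or.inl ⟨h, rfl⟩
  have nB0 : ∀ v, R0 v → cnt (D v) = cnt (T v) + if X v then 1 else 0 := by
    intro v h
    have hn : ¬ R1 v := fun h' => by have h1 := h.2; have h2 := h'.2; omega
    have : cnt (D v) = cnt (fun u => T v u ∨ (X v ∧ u = x v)) := by
      apply cnt_congr; intro u
      exact ⟨fun h' => h'.resolve_left fun h'' => hn h''.1, fun h' => Or.inr h'⟩
    rw [this, cnt_or, cnt_and_const, cnt_eq]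
    rintro u h1 ⟨h2, rfl⟩
    exact (hx v h.1).2.2 (T1 _ _ h1).2.1
  have m3A : ∀ u, A u → n3 A m F u = cnt (F u) := by intro u h; simp [n3, h]
  have m3B : ∀ u, ¬ A u → n3 A m F u = m u + cnt (F u) := by intro u h; simp [n3, h]
  refine ⟨fun u v => D u v ∨ D v u, F, ?_, F1, ?_, fun u v h => (F2 u v h).1, ?_, ?_, ?_⟩
  · intro u v h; exact h.symm
  · rintro u v (h | h)
    · exact hDH _ _ h
    · exact (hDH _ _ h).symm
  · have key : ∀ u v, D u v → ¬ F u v := by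
      rintro u v (⟨h, rfl⟩ | h | ⟨h, rfl⟩) hF
      · exact (F2 _ _ hF).2.2 (hg u h.1).1
      · exact (F2 _ _ hF).2.2 (T1 _ _ h).2.1
      · have h1 := h.1.2
        have h2 : cnt (F u) = 0 := by omega
        exact cnt_eq_zero.1 h2 _ hF
    rintro u v (h | h) hF
    · exact key _ _ h hF
    · exact key _ _ h (F1 _ _ hF)
  · intro v hv
    by_cases hU : U v
    · right; left
      rw [m3A v (hUA v hU), FU v hU]
    have hL : L v := ⟨hv, hU⟩
    by_cases hA : A v
    · rw [nA v hA hU, m3A v hA]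
      have h1 := nA1 v hA hU
      have h2 := FA v hL hA
      rcases Nat.le_one_iff_eq_zero_or_eq_one.1 h1 with h | h
      · exact Or.inl h
      · exact Or.inr (Or.inr ⟨h, h2⟩)
    · rw [nB v hA, m3B v hA]
      by_cases hR : R v
      · by_cases h1 : R1 v
        · right; right; exact ⟨nB1 v h1, hR.2.2.1⟩
        · right; left
          by_contra h
          exact h1 ⟨hR, by omega⟩
      · left; exact nBn v hR
  · rintro u v hu hv hAu hAv hadj ⟨q2, q3⟩
    have hUv : ¬ U v := fun h => hAv (hUA v h)
    have hLv : L v := ⟨hv, hUv⟩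
    rw [nB v hAv] at q2
    rw [m3A u hAu, m3B v hAv] at q3
    by_cases hU : U u
    · rw [cU u hU] at q2
      rw [FU u hU] at q3
      have hmu := ((hUdef u).1 hU).2
      have ha : 0 < a u := by simp only [a]; omega
      by_cases hR : R v
      · have hR0 : R0 v := ⟨hR, q3.symm⟩
        rw [nB0 v hR0] at q2
        have hE : R0 v ∧ U u ∧ H.Adj v u := ⟨hR0, hU, hadj.symm⟩
        rcases T2 v ⟨u, hE⟩ with ⟨h1, h2⟩ | ⟨h1, h2⟩
        · have := h2 u hE
          have hX : ¬ X v := fun h => by have := h.2.1; omega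
          rw [if_neg hX] at q2
          omega
        · have := h2 u hE
          rw [q2] at this
          by_cases hX : X v
          · rw [if_pos hX] at this
            exact absurd hX.2.2.add_one (Nat.not_odd_iff_even.2 this)
          · rw [if_neg hX] at this
            exact hX ⟨hR0, h1, by simpa using this⟩
      · rw [nBn v hR] at q2; omega
    · rw [nA u hAu hU] at q2
      have hLu : L u := ⟨hu, hU⟩
      have hadj' : H'.Adj v u := ⟨hadj.symm, hUv, hU⟩
      have hev := FA u hLu hAu
      rw [q3] at hev
      have hrt : ρ v = v := by
        by_contra h
        exact FB v hLv hAv h hev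
      have hR : R v := ⟨hLv, hrt, hev, u, hadj'⟩
      have hρu : ρ u = v := by rw [← hρc v u hadj'.reachable, hrt]
      by_cases hX : X v
      · have := nB0 v hX.1
        rw [if_pos hX] at this
        have := nA1 u hAu hU
        have := hX.2.1
        omega
      · have h0 : cnt (fun v => D v u) = 0 := by
          rw [cnt_eq_zero]
          intro z hz
          obtain ⟨h1, h2⟩ := dA u z hAu hU hz
          rw [hρu] at h2; subst h2; exact hX h1
        rw [h0] at q2
        by_cases h1 : R1 v
        · rw [nB1 v h1] at q2; omega
        · have hR0 : R0 v := ⟨hR, by by_contra h; exact h1 ⟨hR, by omega⟩⟩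
          rw [nB0 v hR0] at q2
          obtain ⟨hg1, hg2⟩ := hg v hR
          rcases T2 v ⟨g v, hR0, hg1, hg2⟩ with ⟨h1, h2⟩ | ⟨h1, h2⟩ <;> omega

end plus

section glue
variable {V : Type*} [Fintype V]

lemma Good.mono {H : SimpleGraph V} {A : V → Prop} {m : V → ℕ} {C C' : V → Prop}
    {T2 T3 : V → V → Prop} (g : Good H A m C T2 T3) (h : ∀ v, C' v → C v) :
    Good H A m C' T2 T3 :=
  ⟨g.symm2, g.symm3, g.le2, g.le3, g.disj, fun v hv => g.ok v (h v hv),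
    fun u v hu hv => g.ne u v (h u hu) (h v hv)⟩

lemma base_good {H : SimpleGraph V} {A : V → Prop} {m : V → ℕ}
    (bip : ∀ u v, H.Adj u v → (A u ↔ ¬ A v))
    (hK2 : ∀ u v, H.Adj u v → (∀ x, H.Adj u x → x = v) → (∀ x, H.Adj v x → x = u) →
      0 < m u ∨ 0 < m v) :
    ∃ T2 T3, Good H A m (fun _ => True) T2 T3 := by
  have key : ∀ C : H.ConnectedComponent, ∃ T2 T3,
      Good H A m (fun v => H.connectedComponentMk v = C) T2 T3 := by
    intro C
    obtain ⟨w, rfl⟩ := C.exists_rep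
    by_cases h : ∃ u, (A u ∧ 0 < m u) ∧ H.Reachable w u
    · obtain ⟨u, hu, hr⟩ := h
      obtain ⟨T2, T3, g⟩ := plus_good (m := m) bip
      refine ⟨T2, T3, g.mono ?_⟩
      intro v hv
      exact ⟨u, hu, (SimpleGraph.ConnectedComponent.eq.1 hv).trans hr⟩
    · push Not at h
      obtain ⟨T2, T3, g⟩ := comp_good (m := m) bip w (by
        intro v hv hA
        by_contra hm
        exact h v ⟨hA, by omega⟩ hv.symm) hK2
      exact ⟨T2, T3, g.mono fun v hv => SimpleGraph.ConnectedComponent.eq.1 hv⟩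
  choose T2 T3 g using key
  have hc : ∀ {u v}, H.Adj u v → H.connectedComponentMk u = H.connectedComponentMk v :=
    fun h => SimpleGraph.ConnectedComponent.eq.2 h.reachable
  refine ⟨fun u => T2 (H.connectedComponentMk u) u, fun u => T3 (H.connectedComponentMk u) u,
    ?_, ?_, ?_, ?_, ?_, ?_, ?_⟩
  · intro u v h
    have := hc ((g _).le2 _ _ h)
    simp only [this] at h
    exact (g _).symm2 _ _ h
  · intro u v h
    have := hc ((g _).le3 _ _ h)
    simp only [this] at h
    exact (g _).symm3 _ _ h
  · intro u v h; exact (g _).le2 _ _ h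
  · intro u v h; exact (g _).le3 _ _ h
  · intro u v h; exact (g _).disj _ _ h
  · intro v _; exact (g (H.connectedComponentMk v)).ok v rfl
  · intro u v _ _ hA hB hadj
    have h1 := (g (H.connectedComponentMk v)).ne u v (hc hadj) rfl hA hB hadj
    rw [← hc hadj] at h1
    have h2 : H.connectedComponentMk u = H.connectedComponentMk v := hc hadj
    simp only [n2, n3] at h1 ⊢
    rw [← h2]
    exact h1

end glue

section upper
variable {V : Type*} [Fintype V]

structure MinCol (G : SimpleGraph V) (c : V → ℕ) : Prop where
  prop : ∀ u v, G.Adj u v → c u ≠ c v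
  min : ∀ c' : V → ℕ, (∀ u v, G.Adj u v → c' u ≠ c' v) → ∑ v, c v ≤ ∑ v, c' v

lemma exists_minCol (G : SimpleGraph V) : ∃ c, MinCol G c := by
  classical
  have h : ∃ n, ∃ c : V → ℕ, (∀ u v, G.Adj u v → c u ≠ c v) ∧ ∑ v, c v = n := by
    refine ⟨_, fun v => (Fintype.equivFin V v : ℕ), ?_, rfl⟩
    intro u v h h'
    exact h.ne ((Fintype.equivFin V).injective (Fin.ext h'))
  obtain ⟨c, h1, h2⟩ := Nat.find_spec h
  refine ⟨c, h1, fun c' h' => ?_⟩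
  rw [h2]
  exact Nat.find_min' h ⟨c', h', rfl⟩

lemma MinCol.greedy {G : SimpleGraph V} {c : V → ℕ} (hc : MinCol G c) (v : V) (j : ℕ)
    (hj : j < c v) : ∃ u, G.Adj v u ∧ c u = j := by
  classical
  by_contra hn
  push Not at hn
  have h := hc.min (Function.update c v j) (by
    intro x y hxy
    by_cases hx : x = v
    · subst hx
      rw [Function.update_self, Function.update_of_ne hxy.ne']
      exact (hn y hxy).symm
    · by_cases hy : y = v
      · subst hy
        rw [Function.update_self, Function.update_of_ne hxy.ne]
        exact hn x hxy.symm
      · rw [Function.update_of_ne hx, Function.update_of_ne hy]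
        exact hc.prop x y hxy)
  have h2 : ∑ x, Function.update c v j x < ∑ x, c x := by
    apply Finset.sum_lt_sum
    · intro x _
      by_cases hx : x = v
      · subst hx; rw [Function.update_self]; exact hj.le
      · rw [Function.update_of_ne hx]
    · exact ⟨v, Finset.mem_univ v, by rw [Function.update_self]; exact hj⟩
  omega

/-- `u v` form a `K_2` component of the base. -/
def Kp (G : SimpleGraph V) (B : V → Prop) (u v : V) : Prop :=
  G.Adj u v ∧ B u ∧ B v ∧ (∀ x, G.Adj u x → B x → x = v) ∧ (∀ x, G.Adj v x → B x → x = u)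

lemma Kp.symm {G : SimpleGraph V} {B : V → Prop} {u v : V} (h : Kp G B u v) : Kp G B v u :=
  ⟨h.1.symm, h.2.2.1, h.2.1, h.2.2.2.2, h.2.2.2.1⟩

lemma Kp.uniq {G : SimpleGraph V} {B : V → Prop} {u v v' : V} (h : Kp G B u v)
    (h' : Kp G B u v') : v' = v := h.2.2.2.1 v' h'.1 h'.2.2.1

lemma MinCol.flip {G : SimpleGraph V} {c : V → ℕ} (hc : MinCol G c) {B : V → Prop}
    (hB : ∀ v, B v ↔ c v < 2) (S : V → Prop) (hS : ∀ u v, S u → Kp G B u v → S v) :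
    ∃ c', MinCol G c' ∧ (∀ v, B v ↔ c' v < 2) ∧ (∀ u, 2 ≤ c u → c' u = c u) ∧
      (∀ u v, S u → Kp G B u v → c' u = 1 - c u) ∧
      (∀ u, (∀ v, S u → ¬ Kp G B u v) → c' u = c u) := by
  classical
  have hσ : ∀ u, ∃ v, (S u ∧ Kp G B u v) ∨ (v = u ∧ ∀ v, S u → ¬ Kp G B u v) := by
    intro u
    by_cases h : ∃ v, S u ∧ Kp G B u v
    · obtain ⟨v, hv⟩ := h; exact ⟨v, Or.inl hv⟩
    · push Not at h; exact ⟨u, Or.inr ⟨rfl, h⟩⟩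
  choose σ hσ using hσ
  have h1 : ∀ u v, S u → Kp G B u v → σ u = v := by
    intro u v hu hv
    rcases hσ u with h | h
    · exact hv.uniq h.2
    · exact absurd hv (h.2 v hu)
  have h2 : ∀ u, (∀ v, S u → ¬ Kp G B u v) → σ u = u := by
    intro u h
    rcases hσ u with h' | h'
    · exact absurd h'.2 (h _ h'.1)
    · exact h'.1
  have hinv : Function.Involutive σ := by
    intro u
    rcases hσ u with h | h
    · exact h1 _ _ (hS _ _ h.1 h.2) h.2.symm
    · rw [h.1, h.1]
  have h3 : ∀ u v, S u → Kp G B u v → c (σ u) = 1 - c u := by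
    intro u v hu hv
    rw [h1 u v hu hv]
    have a1 := (hB _).1 hv.2.1
    have a2 := (hB _).1 hv.2.2.1
    have a3 := hc.prop _ _ hv.1
    omega
  have hb : ∀ v, B v ↔ c (σ v) < 2 := by
    intro v
    rcases hσ v with h | h
    · rw [h3 _ _ h.1 h.2, hB]
      have := (hB _).1 h.2.2.1
      omega
    · rw [h.1, hB]
  have hprop : ∀ u v, G.Adj u v → c (σ u) ≠ c (σ v) := by
    -- if `u` is flipped then `v` is its mate or an upper vertex
    have key : ∀ u v, G.Adj u v → (S u ∧ Kp G B u (σ u)) → c (σ u) ≠ c (σ v) := by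
      intro u v hadj h
      by_cases hv : B v
      · have e : v = σ u := h.2.2.2.2.1 v hadj hv
        rw [← e] at h
        rw [h1 _ _ h.1 h.2, h1 _ _ (hS _ _ h.1 h.2) h.2.symm]
        exact (hc.prop _ _ hadj).symm
      · have a1 := (hb u).1 h.2.2.1
        have a2 : ¬ c (σ v) < 2 := fun h => hv ((hb v).2 h)
        omega
    intro u v hadj
    rcases hσ u with h | h
    · exact key u v hadj h
    · rcases hσ v with h' | h'
      · exact (key v u hadj.symm h').symm
      · rw [h.1, h'.1]; exact hc.prop _ _ hadj
  refine ⟨fun v => c (σ v), ⟨hprop, ?_⟩, hb, ?_, h3, ?_⟩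
  · intro c' h'
    have : ∑ v, c (σ v) = ∑ v, c v := Equiv.sum_comp hinv.toPerm c
    rw [this]; exact hc.min c' h'
  · intro u hu
    show c (σ u) = c u
    rw [h2 u]
    intro v _ hk
    have := (hB _).1 hk.2.1
    omega
  · intro u h
    simp only [h2 u h]

/-- A colouring together with attachments of the `K_2` components. -/
structure Attached (G : SimpleGraph V) (c : V → ℕ) (B : V → Prop) (Att : V → V → Prop) : Prop where
  mc : MinCol G c
  hB : ∀ v, B v ↔ c v < 2
  ex : ∀ u v, Kp G B u v → (∃ w, Att u w) ∨ (∃ w, Att v w)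
  adj : ∀ u w, Att u w → ¬ B w ∧ G.Adj u w ∧ ∃ v, Kp G B u v
  col : ∀ u w, Att u w → c u = c w % 2
  mate : ∀ u v w w', Att u w → Kp G B u v → ¬ Att v w'

lemma exists_attached (G : SimpleGraph V) (h2 : ∀ u v, ∃ x, G.Adj u x ∧ x ≠ v) :
    ∃ c B Att, Attached G c B Att := by
  classical
  obtain ⟨c, hc⟩ := exists_minCol G
  let B : V → Prop := fun v => c v < 2
  have hw : ∀ u, ∃ w, (∃ v, Kp G B u v) → G.Adj u w ∧ ¬ B w := by
    intro u
    by_cases h : ∃ v, Kp G B u v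
    · obtain ⟨v, hv⟩ := h
      obtain ⟨x, hx, hne⟩ := h2 u v
      exact ⟨x, fun _ => ⟨hx, fun hb => hne (hv.2.2.2.1 x hx hb)⟩⟩
    · exact ⟨u, fun h' => absurd h' h⟩
  choose wf hwf using hw
  let Att : V → V → Prop := fun u w => (∃ v, Kp G B u v) ∧ c u = 0 ∧ w = wf u
  have hc01 : ∀ u v, Kp G B u v → (c u = 0 ∧ c v = 1) ∨ (c u = 1 ∧ c v = 0) := by
    intro u v h
    have a1 : c u < 2 := h.2.1
    have a2 : c v < 2 := h.2.2.1
    have a3 := hc.prop _ _ h.1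
    omega
  let S0 : V → Prop := fun u => ∃ w, Att u w ∧ c w % 2 = 1
  obtain ⟨c', hc', hB', g1, g2, g3⟩ := hc.flip (B := B) (fun _ => Iff.rfl)
    (fun u => S0 u ∨ ∃ v, Kp G B u v ∧ S0 v) (by
      rintro u v (h | ⟨v', h', h⟩) hk
      · exact Or.inr ⟨u, hk.symm, h⟩
      · rw [hk.uniq h'] at h; exact Or.inl h)
  refine ⟨c', B, Att, hc', hB', ?_, ?_, ?_, ?_⟩
  · intro u v h
    rcases hc01 u v h with h' | h'
    · exact Or.inl ⟨_, ⟨v, h⟩, h'.1, rfl⟩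
    · exact Or.inr ⟨_, ⟨u, h.symm⟩, h'.2, rfl⟩
  · rintro u w ⟨h, h0, rfl⟩
    exact ⟨(hwf u h).2, (hwf u h).1, h⟩
  · intro u w hA
    obtain ⟨⟨v, h⟩, h0, hw⟩ := id hA
    have hcw : c' w = c w := by
      apply g1
      have := (hwf u ⟨v, h⟩).2
      rw [← hw] at this
      exact not_lt.1 this
    rw [hcw]
    by_cases hp : c w % 2 = 1
    · rw [g2 u v (Or.inl ⟨w, hA, hp⟩) h, h0]; omega
    · rw [g3 u, h0]
      · omega
      · rintro v' (⟨w', h1, h2⟩ | ⟨v'', h1, ⟨w', h2, h3⟩⟩) hk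
        · rw [h1.2.2, ← hw] at h2; exact hp h2
        · have := hc01 _ _ h1
          have := h2.2.1
          omega
  · rintro u v w w' ⟨_, h0, _⟩ hk ⟨_, h0', _⟩
    have := hc01 _ _ hk
    omega

lemma w_lemma {G : SimpleGraph V} {c : V → ℕ} {B : V → Prop} {Att : V → V → Prop}
    (at' : Attached G c B Att) (w : V) (hw : 2 ≤ c w) :
    ∃ (o z : V) (Req : V → Prop), G.Adj w o ∧ c o = 1 - c w % 2 ∧ G.Adj w z ∧ c z = c w % 2 ∧
      ¬ Req z ∧ (∀ x, Req x → G.Adj w x ∧ c x = c w % 2) ∧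
      ∀ d, Att d w → Req d ∨ Kp G B d o := by
  classical
  by_cases h : ∃ d v, Att d w ∧ Kp G B d v ∧ G.Adj w v
  · obtain ⟨d, v, h1, h2, h3⟩ := h
    have hcd := at'.col _ _ h1
    refine ⟨v, d, fun x => Att x w ∧ x ≠ d, h3, ?_, (at'.adj _ _ h1).2.1.symm, hcd, ?_, ?_, ?_⟩
    · have a1 := at'.mc.prop _ _ h2.1
      have a2 := (at'.hB _).1 h2.2.2.1
      omega
    · intro h; exact h.2 rfl
    · intro x hx; exact ⟨(at'.adj _ _ hx.1).2.1.symm, at'.col _ _ hx.1⟩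
    · intro x hx
      by_cases hxd : x = d
      · subst hxd; exact Or.inr h2
      · exact Or.inl ⟨hx, hxd⟩
  · push Not at h
    obtain ⟨o, ho1, ho2⟩ := at'.mc.greedy w (1 - c w % 2) (by omega)
    obtain ⟨c', hc', hB', g1, g2, g3⟩ := at'.mc.flip at'.hB
      (fun u => Att u w ∨ ∃ v, Kp G B u v ∧ Att v w) (by
        rintro u v (h | ⟨v', h', h⟩) hk
        · exact Or.inr ⟨u, hk.symm, h⟩
        · rw [hk.uniq h'] at h; exact Or.inl h)
    have hcw := g1 w hw
    obtain ⟨z, hz1, hz2⟩ := hc'.greedy w (c w % 2) (by omega)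
    have hz3 : ¬ Att z w := by
      intro hz
      obtain ⟨_, _, v, hk⟩ := at'.adj _ _ hz
      rw [g2 z v (Or.inl hz) hk, at'.col _ _ hz] at hz2
      omega
    have hz4 : c' z = c z := by
      apply g3
      rintro v (hz | ⟨v', h1, h2⟩) hk
      · exact hz3 hz
      · exact h v' z h2 h1.symm hz1
    refine ⟨o, z, fun x => Att x w, ho1, ho2, hz1, by rw [← hz4, hz2], hz3, ?_, ?_⟩
    · intro x hx; exact ⟨(at'.adj _ _ hx).2.1.symm, at'.col _ _ hx⟩
    · intro d hd; exact Or.inl hd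

lemma f_lemma {G : SimpleGraph V} {c : V → ℕ} {B : V → Prop} {Att : V → V → Prop}
    (at' : Attached G c B Att) (w : V) (hw : 2 ≤ c w) (U : ℕ) :
    ∃ M : Finset V, (∀ x ∈ M, G.Adj w x ∧ c x < c w) ∧
      cnt (fun x => x ∈ M ∧ c x % 2 ≠ c w % 2) = (c w + 1) / 2 ∧
      0 < U + cnt (fun x => x ∈ M ∧ c x % 2 = c w % 2) ∧
      (U + cnt (fun x => x ∈ M ∧ c x % 2 = c w % 2) + (c w + 1) / 2) % 2 = c w % 2 ∧
      ∀ d, Att d w → d ∈ M ∨ ∃ v ∈ M, Kp G B d v := by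
  classical
  obtain ⟨o, z, Req, ho1, ho2, hz1, hz2, hz3, hR, hAtt⟩ := w_lemma at' w hw
  -- neighbours of each smaller colour
  have hnb : ∀ k, ∃ x, k < (c w + 1) / 2 → G.Adj w x ∧ c x = 2 * k + (1 - c w % 2) ∧
      (k = 0 → x = o) := by
    intro k
    by_cases hk : k < (c w + 1) / 2
    · by_cases h0 : k = 0
      · exact ⟨o, fun _ => ⟨ho1, by omega, fun _ => rfl⟩⟩
      · obtain ⟨x, hx1, hx2⟩ := at'.mc.greedy w (2 * k + (1 - c w % 2)) (by omega)
        exact ⟨x, fun _ => ⟨hx1, hx2, fun h => absurd h h0⟩⟩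
    · exact ⟨w, fun h => absurd h hk⟩
  choose nb hnb using hnb
  let Opp := (Finset.range ((c w + 1) / 2)).image nb
  have hOppc : Opp.card = (c w + 1) / 2 := by
    rw [Finset.card_image_of_injOn, Finset.card_range]
    intro k hk l hl hkl
    have h1 := (hnb k (by simpa using hk)).2.1
    have h2 := (hnb l (by simpa using hl)).2.1
    simp only [hkl] at h1
    omega
  have hOpp : ∀ x ∈ Opp, G.Adj w x ∧ c x < c w ∧ c x % 2 ≠ c w % 2 := by
    intro x hx
    simp only [Opp, Finset.mem_image, Finset.mem_range] at hx
    obtain ⟨k, hk, rfl⟩ := hx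
    have := hnb k hk
    refine ⟨this.1, ?_, ?_⟩ <;> omega
  have hoM : o ∈ Opp := by
    simp only [Opp, Finset.mem_image, Finset.mem_range]
    exact ⟨0, by omega, (hnb 0 (by omega)).2.2 rfl⟩
  -- it suffices to find the own part
  suffices hown : ∃ Own : Finset V, (∀ x ∈ Own, G.Adj w x ∧ c x < c w ∧ c x % 2 = c w % 2) ∧
      (∀ x, Req x → x ∈ Own) ∧ 0 < U + Own.card ∧
      (U + Own.card + (c w + 1) / 2) % 2 = c w % 2 by
    obtain ⟨Own, w1, w2, w3, w4⟩ := hown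
    have e1 : cnt (fun x => x ∈ Opp ∪ Own ∧ c x % 2 ≠ c w % 2) = Opp.card := by
      rw [← cnt_mem]
      apply cnt_congr
      intro x
      rw [Finset.mem_union]
      constructor
      · rintro ⟨h | h, h'⟩
        · exact h
        · exact absurd (w1 x h).2.2 h'
      · intro h; exact ⟨Or.inl h, (hOpp x h).2.2⟩
    have e2 : cnt (fun x => x ∈ Opp ∪ Own ∧ c x % 2 = c w % 2) = Own.card := by
      rw [← cnt_mem]
      apply cnt_congr
      intro x
      rw [Finset.mem_union]
      constructor
      · rintro ⟨h | h, h'⟩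
        · exact absurd h' (hOpp x h).2.2
        · exact h
      · intro h; exact ⟨Or.inr h, (w1 x h).2.2⟩
    refine ⟨Opp ∪ Own, ?_, by rw [e1, hOppc], by rw [e2]; exact w3, by rw [e2]; exact w4, ?_⟩
    · intro x hx
      rcases Finset.mem_union.1 hx with h | h
      · exact ⟨(hOpp x h).1, (hOpp x h).2.1⟩
      · exact ⟨(w1 x h).1, (w1 x h).2.1⟩
    · intro d hd
      rcases hAtt d hd with h | h
      · exact Or.inl (Finset.mem_union_right _ (w2 d h))
      · exact Or.inr ⟨o, Finset.mem_union_left _ hoM, h⟩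
  let RF := Finset.univ.filter Req
  have hRF : ∀ x ∈ RF, G.Adj w x ∧ c x < c w ∧ c x % 2 = c w % 2 := by
    intro x hx
    have := hR x (by simpa [RF] using hx)
    refine ⟨this.1, ?_, ?_⟩ <;> omega
  have hRF' : ∀ x, Req x → x ∈ RF := by intro x hx; simpa [RF] using hx
  by_cases hp : (U + RF.card + (c w + 1) / 2) % 2 = c w % 2
  · by_cases hpos : 0 < U + RF.card
    · exact ⟨RF, hRF, hRF', hpos, hp⟩
    · have hz0 : RF.card = 0 := by omega
      have hempty : ∀ x, ¬ Req x := by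
        intro x hx
        rw [Finset.card_eq_zero] at hz0
        have := hRF' x hx
        rw [hz0] at this
        simp at this
      obtain ⟨y, hy1, hy2⟩ := at'.mc.greedy w (c w % 2 + 2) (by omega)
      have hzy : z ≠ y := by rintro rfl; omega
      refine ⟨{z, y}, ?_, fun x hx => absurd hx (hempty x), ?_, ?_⟩
      · intro x hx
        rw [Finset.mem_insert, Finset.mem_singleton] at hx
        rcases hx with rfl | rfl
        · refine ⟨hz1, ?_, ?_⟩ <;> omega
        · refine ⟨hy1, ?_, ?_⟩ <;> omega
      · rw [Finset.card_pair hzy]; omega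
      · rw [Finset.card_pair hzy]; omega
  · have hzR : z ∉ RF := by simpa [RF] using hz3
    refine ⟨insert z RF, ?_, fun x hx => Finset.mem_insert_of_mem (hRF' x hx), ?_, ?_⟩
    · intro x hx
      rcases Finset.mem_insert.1 hx with rfl | h
      · refine ⟨hz1, ?_, ?_⟩ <;> omega
      · exact hRF x h
    · rw [Finset.card_insert_of_notMem hzR]; omega
    · rw [Finset.card_insert_of_notMem hzR]; omega

lemma rec_exists (c : V → ℕ) (f : V → ℕ → Finset V) :
    ∃ M : V → Finset V, ∀ w, M w = f w (cnt (fun z => c w < c z ∧ w ∈ M z)) := by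
  have hwf : WellFounded (fun z w : V => c w < c z) := by
    have : IsTrans V (fun z w : V => c w < c z) := ⟨fun a b d h1 h2 => lt_trans h2 h1⟩
    have : Std.Irrefl (fun z w : V => c w < c z) := ⟨fun a h => lt_irrefl _ h⟩
    exact Finite.wellFounded_of_trans_of_irrefl _
  refine ⟨hwf.fix (fun w rec => f w (cnt (fun z => ∃ h : c w < c z, w ∈ rec z h))), fun w => ?_⟩
  rw [hwf.fix_eq]
  simp only [exists_prop]

lemma upper (G : SimpleGraph V) (h2 : ∀ u v, ∃ x, G.Adj u x ∧ x ≠ v) :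
    ∃ (c : V → ℕ) (M : V → Finset V), (∀ u v, G.Adj u v → c u ≠ c v) ∧
      (∀ w, ∀ x ∈ M w, G.Adj w x ∧ c x < c w ∧ 2 ≤ c w) ∧
      (∀ w, 2 ≤ c w → cnt (fun x => x ∈ M w ∧ c x % 2 ≠ c w % 2) = (c w + 1) / 2 ∧
        0 < cnt (fun z => w ∈ M z) + cnt (fun x => x ∈ M w ∧ c x % 2 = c w % 2) ∧
        (cnt (fun z => w ∈ M z) + cnt (fun x => x ∈ M w ∧ c x % 2 = c w % 2)
          + (c w + 1) / 2) % 2 = c w % 2) ∧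
      ∀ u v, Kp G (fun v => c v < 2) u v → 0 < cnt (fun z => u ∈ M z) ∨ 0 < cnt (fun z => v ∈ M z) := by
  classical
  obtain ⟨c, B, Att, at'⟩ := exists_attached G h2
  have hf : ∀ w U, ∃ M : Finset V, (c w < 2 → M = ∅) ∧ (2 ≤ c w →
      (∀ x ∈ M, G.Adj w x ∧ c x < c w) ∧
      cnt (fun x => x ∈ M ∧ c x % 2 ≠ c w % 2) = (c w + 1) / 2 ∧
      0 < U + cnt (fun x => x ∈ M ∧ c x % 2 = c w % 2) ∧
      (U + cnt (fun x => x ∈ M ∧ c x % 2 = c w % 2) + (c w + 1) / 2) % 2 = c w % 2 ∧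
      ∀ d, Att d w → d ∈ M ∨ ∃ v ∈ M, Kp G B d v) := by
    intro w U
    by_cases hw : 2 ≤ c w
    · obtain ⟨M, hM⟩ := f_lemma at' w hw U
      exact ⟨M, fun h => absurd h (by omega), fun _ => hM⟩
    · exact ⟨∅, fun _ => rfl, fun h => absurd h hw⟩
  choose f hf0 hf using hf
  obtain ⟨M, hM⟩ := rec_exists c f
  have hsub : ∀ w, ∀ x ∈ M w, G.Adj w x ∧ c x < c w ∧ 2 ≤ c w := by
    intro w x hx
    rw [hM] at hx
    by_cases hw : 2 ≤ c w
    · have := (hf w _ hw).1 x hx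
      exact ⟨this.1, this.2, hw⟩
    · rw [hf0 w _ (by omega)] at hx; simp at hx
  have hcnt : ∀ w, cnt (fun z => c w < c z ∧ w ∈ M z) = cnt (fun z => w ∈ M z) := by
    intro w
    apply cnt_congr
    intro z
    exact ⟨fun h => h.2, fun h => ⟨(hsub z w h).2.1, h⟩⟩
  have hM' : ∀ w, M w = f w (cnt (fun z => w ∈ M z)) := fun w => by
    rw [← hcnt]; exact hM w
  refine ⟨c, M, at'.mc.prop, hsub, ?_, ?_⟩
  · intro w hw
    have h := hf w (cnt (fun z => w ∈ M z)) hw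
    rw [← hM'] at h
    exact ⟨h.2.1, h.2.2.1, h.2.2.2.1⟩
  · have hBe : (fun v => c v < 2) = B := funext fun v => propext (at'.hB v).symm
    rw [hBe]
    have key : ∀ u v w, Kp G B u v → Att u w →
        0 < cnt (fun z => u ∈ M z) ∨ 0 < cnt (fun z => v ∈ M z) := by
      intro u v w hk ha
      have hw : 2 ≤ c w := by
        have := (at'.adj _ _ ha).1
        rw [at'.hB] at this
        omega
      have h := (hf w (cnt (fun z => w ∈ M z)) hw).2.2.2.2 u ha
      rw [← hM'] at h
      rcases h with h | ⟨v', h, hk'⟩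
      · exact Or.inl (cnt_pos.2 ⟨w, h⟩)
      · rw [hk.uniq hk'] at h; exact Or.inr (cnt_pos.2 ⟨w, h⟩)
    intro u v hk
    rcases at'.ex u v hk with ⟨w, hw⟩ | ⟨w, hw⟩
    · exact key u v w hk hw
    · exact (key v u w hk.symm hw).symm

end upper

section final
variable {V : Type*} [Fintype V]

lemma codes (G : SimpleGraph V) (h2 : ∀ u v, ∃ x, G.Adj u x ∧ x ≠ v) :
    ∃ S0 S1 : V → V → Prop, (∀ u v, S0 u v → S0 v u) ∧ (∀ u v, S1 u v → S1 v u) ∧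
      (∀ u v, S0 u v → G.Adj u v) ∧ (∀ u v, S1 u v → G.Adj u v) ∧
      (∀ u v, S0 u v → ¬ S1 u v) ∧
      ∀ u v, G.Adj u v → ¬ (cnt (S0 u) = cnt (S0 v) ∧ cnt (S1 u) = cnt (S1 v)) := by
  classical
  obtain ⟨c, M, hc, hM, hup, hK⟩ := upper G h2
  let m : V → ℕ := fun x => cnt (fun z => x ∈ M z)
  let A : V → Prop := fun v => c v = 0
  let H : SimpleGraph V :=
    { Adj := fun u v => G.Adj u v ∧ c u < 2 ∧ c v < 2
      symm := ⟨fun _ _ h => ⟨h.1.symm, h.2.2, h.2.1⟩⟩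
      loopless := ⟨fun _ h => h.1.ne rfl⟩ }
  obtain ⟨T2, T3, g⟩ := base_good (H := H) (A := A) (m := m) (by
      intro u v h
      have := hc u v h.1
      have h1 := h.2.1
      have h2 := h.2.2
      simp only [A]; omega) (by
      intro u v h hu hv
      exact hK u v ⟨h.1, h.2.1, h.2.2, fun x hx hb => hu x ⟨hx, h.2.1, hb⟩,
        fun x hx hb => hv x ⟨hx, h.2.2, hb⟩⟩)
  let S : ℕ → (V → V → Prop) → V → V → Prop := fun p T u v =>
    (v ∈ M u ∧ c v % 2 = p) ∨ (u ∈ M v ∧ c u % 2 = p) ∨ T u v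
  have hcount : ∀ p T, (∀ u v, T u v → H.Adj u v) → ∀ v, cnt (S p T v) =
      cnt (fun x => x ∈ M v ∧ c x % 2 = p) + ((if c v % 2 = p then m v else 0) + cnt (T v)) := by
    intro p T hT v
    have e : cnt (fun x => v ∈ M x ∧ c v % 2 = p) = if c v % 2 = p then m v else 0 := by
      rw [← cnt_and_const]
      apply cnt_congr; intro x; exact and_comm
    rw [← e, ← cnt_or, ← cnt_or]
    · rintro x h1 (h | h)
      · have a1 := (hM _ _ h1.1).2.1
        have a2 := (hM _ _ h.1).2.1
        omega
      · have a1 := (hM _ _ h1.1).2.2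
        have a2 := (hT _ _ h).2.1
        omega
    · rintro x h1 h
      have a1 := (hM _ _ h1.1).2.2
      have a2 := (hT _ _ h).2.2
      omega
  have h0 := hcount 0 T2 g.le2
  have h1 := hcount 1 T3 g.le3
  have hbM : ∀ v p, c v < 2 → cnt (fun x => x ∈ M v ∧ c x % 2 = p) = 0 := by
    intro v p hv
    rw [cnt_eq_zero]
    rintro x ⟨hx, _⟩
    have := (hM _ _ hx).2.2
    omega
  have b0 : ∀ v, c v < 2 → cnt (S 0 T2 v) = n2 A m T2 v := by
    intro v hv
    rw [h0, hbM v 0 hv, n2, zero_add]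
    have : c v % 2 = 0 ↔ A v := by simp only [A]; omega
    by_cases hA : A v
    · rw [if_pos (this.2 hA), if_pos hA]
    · rw [if_neg (by rw [this]; exact hA), if_neg hA]
  have b1 : ∀ v, c v < 2 → cnt (S 1 T3 v) = n3 A m T3 v := by
    intro v hv
    rw [h1, hbM v 1 hv, n3, zero_add]
    have : c v % 2 = 1 ↔ ¬ A v := by simp only [A]; omega
    by_cases hA : A v
    · rw [if_neg (by rw [this]; simpa using hA), if_pos hA]
    · rw [if_pos (this.2 hA), if_neg hA]
  have hup' : ∀ v, 2 ≤ c v →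
      (c v % 2 = 0 → cnt (S 1 T3 v) = (c v + 1) / 2 ∧ 0 < cnt (S 0 T2 v)) ∧
      (c v % 2 = 1 → cnt (S 0 T2 v) = (c v + 1) / 2 ∧ 0 < cnt (S 1 T3 v)) ∧
      (cnt (S 0 T2 v) + cnt (S 1 T3 v)) % 2 = c v % 2 := by
    intro v hv
    obtain ⟨u1, u2, u3⟩ := hup v hv
    have t2 : cnt (T2 v) = 0 := cnt_eq_zero.2 fun x hx => by
      have := (g.le2 _ _ hx).2.1; omega
    have t3 : cnt (T3 v) = 0 := cnt_eq_zero.2 fun x hx => by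
      have := (g.le3 _ _ hx).2.1; omega
    rw [h0, h1, t2, t3]
    rcases Nat.mod_two_eq_zero_or_one (c v) with h | h
    · rw [h] at u1 u2 u3
      have : cnt (fun x => x ∈ M v ∧ c x % 2 = 1) = cnt (fun x => x ∈ M v ∧ c x % 2 ≠ 0) := by
        apply cnt_congr; intro x
        rw [show c x % 2 = 1 ↔ c x % 2 ≠ 0 by omega]
      rw [this]
      simp only [h, m] at *
      simp
      omega
    · rw [h] at u1 u2 u3
      have : cnt (fun x => x ∈ M v ∧ c x % 2 = 0) = cnt (fun x => x ∈ M v ∧ c x % 2 ≠ 1) := by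
        apply cnt_congr; intro x
        rw [show c x % 2 = 0 ↔ c x % 2 ≠ 1 by omega]
      rw [this]
      simp only [h, m] at *
      simp
      omega
  have hmain : ∀ u v, G.Adj u v → c u < c v →
      ¬ (cnt (S 0 T2 u) = cnt (S 0 T2 v) ∧ cnt (S 1 T3 u) = cnt (S 1 T3 v)) := by
    rintro u v hadj hlt ⟨q0, q1⟩
    by_cases hv : c v < 2
    · have hu : c u < 2 := by omega
      rw [b0 u hu, b0 v hv] at q0
      rw [b1 u hu, b1 v hv] at q1
      exact g.ne u v trivial trivial (by simp only [A]; omega) (by simp only [A]; omega)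
        ⟨hadj, hu, hv⟩ ⟨q0, q1⟩
    · have fv := hup' v (by omega)
      by_cases hu : c u < 2
      · have ok := g.ok u trivial
        rw [← b0 u hu, ← b1 u hu, q0, q1] at ok
        rcases ok with ok | ok | ⟨ok1, ok2⟩
        · omega
        · omega
        · rw [Nat.even_iff] at ok2
          omega
      · have fu := hup' u (by omega)
        omega
  have hS : ∀ p T, (∀ u v, T u v → T v u) → ∀ u v, S p T u v → S p T v u := by
    rintro p T hT u v (h | h | h)
    · exact Or.inr (Or.inl h)
    · exact Or.inl h
    · exact Or.inr (Or.inr (hT _ _ h))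
  have hA : ∀ p T, (∀ u v, T u v → H.Adj u v) → ∀ u v, S p T u v → G.Adj u v := by
    rintro p T hT u v (h | h | h)
    · exact (hM _ _ h.1).1
    · exact (hM _ _ h.1).1.symm
    · exact (hT _ _ h).1
  refine ⟨S 0 T2, S 1 T3, hS _ _ g.symm2, hS _ _ g.symm3, hA _ _ g.le2, hA _ _ g.le3, ?_, ?_⟩
  · have k1 : ∀ u v, v ∈ M u → u ∈ M v → False := fun u v a b => by
      have := (hM _ _ a).2.1
      have := (hM _ _ b).2.1
      omega
    have k2 : ∀ u v, v ∈ M u → H.Adj u v → False := fun u v a b => by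
      have := (hM _ _ a).2.2
      have := b.2.1
      omega
    rintro u v (h | h | h) (h' | h' | h')
    · omega
    · exact k1 _ _ h.1 h'.1
    · exact k2 _ _ h.1 (g.le3 _ _ h')
    · exact k1 _ _ h.1 h'.1
    · omega
    · exact k2 _ _ h.1 (g.le3 _ _ h').symm
    · exact k2 _ _ h'.1 (g.le2 _ _ h)
    · exact k2 _ _ h'.1 (g.le2 _ _ h).symm
    · exact g.disj _ _ h h'
  · intro u v hadj
    rcases lt_or_gt_of_ne (hc u v hadj) with h | h
    · exact hmain u v hadj h
    · rintro ⟨a, b⟩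
      exact hmain v u hadj.symm h ⟨a.symm, b.symm⟩

lemma prod_code [DecidableEq V] (G : SimpleGraph V) [DecidableRel G.Adj] (S0 S1 : V → V → Prop)
    (l0 : ∀ u v, S0 u v → G.Adj u v) (l1 : ∀ u v, S1 u v → G.Adj u v)
    (dj : ∀ u v, S0 u v → ¬ S1 u v) (ℓ : Sym2 V → ℕ)
    (e0 : ∀ u v, S0 u v → ℓ s(u, v) = 2) (e1 : ∀ u v, S1 u v → ℓ s(u, v) = 3)
    (e2 : ∀ u v, ¬ S0 u v → ¬ S1 u v → ℓ s(u, v) = 1) (v : V) :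
    vertexProd G ℓ v = 2 ^ cnt (S0 v) * 3 ^ cnt (S1 v) := by
  classical
  have hi : G.incidenceFinset v = (G.neighborFinset v).image (fun x => s(v, x)) := by
    ext e
    induction e with
    | _ a b =>
      simp only [SimpleGraph.mem_incidenceFinset, SimpleGraph.mk'_mem_incidenceSet_iff,
        Finset.mem_image, SimpleGraph.mem_neighborFinset]
      constructor
      · rintro ⟨h, rfl | rfl⟩
        · exact ⟨b, h, rfl⟩
        · exact ⟨a, h.symm, Sym2.eq_swap⟩
      · rintro ⟨x, hx, he⟩
        rcases Sym2.eq_iff.1 he with ⟨rfl, rfl⟩ | ⟨rfl, rfl⟩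
        · exact ⟨hx, Or.inl rfl⟩
        · exact ⟨hx.symm, Or.inr rfl⟩
  have hl : ∀ x, ℓ s(v, x) = (if S0 v x then 2 else 1) * (if S1 v x then 3 else 1) := by
    intro x
    by_cases h0 : S0 v x
    · simp [h0, dj _ _ h0, e0 _ _ h0]
    · by_cases h1 : S1 v x
      · simp [h0, h1, e1 _ _ h1]
      · simp [h0, h1, e2 _ _ h0 h1]
  have hp : ∀ (S : V → V → Prop) (n : ℕ), (∀ u v, S u v → G.Adj u v) →
      ∏ x ∈ G.neighborFinset v, (if S v x then n else 1) = n ^ cnt (S v) := by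
    intro S n hS
    rw [Finset.prod_ite, Finset.prod_const, Finset.prod_const_one, mul_one, cnt]
    congr 2
    ext x
    simp only [Finset.mem_filter, SimpleGraph.mem_neighborFinset, Finset.mem_univ, true_and]
    exact ⟨fun h => h.2, fun h => ⟨hS _ _ h, h⟩⟩
  rw [vertexProd, hi, Finset.prod_image]
  · simp only [hl]
    rw [Finset.prod_mul_distrib, hp S0 2 l0, hp S1 3 l1]
  · intro x _ y _ hxy
    exact Sym2.congr_right.1 hxy

lemma code_inj {a b x y : ℕ} (h : 2 ^ a * 3 ^ b = 2 ^ x * 3 ^ y) : a = x ∧ b = y := by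
  have h2 : ∀ a b : ℕ, (2 ^ a * 3 ^ b).factorization 2 = a := by
    intro a b
    rw [Nat.factorization_mul (by positivity) (by positivity)]
    simp [Nat.Prime.factorization_pow Nat.prime_two, Nat.Prime.factorization_pow Nat.prime_three]
  have h3 : ∀ a b : ℕ, (2 ^ a * 3 ^ b).factorization 3 = b := by
    intro a b
    rw [Nat.factorization_mul (by positivity) (by positivity)]
    simp [Nat.Prime.factorization_pow Nat.prime_two, Nat.Prime.factorization_pow Nat.prime_three]
  constructor
  · rw [← h2 a b, h, h2]
  · rw [← h3 a b, h, h3]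

lemma main_lab [DecidableEq V] (G : SimpleGraph V) [DecidableRel G.Adj]
    (h2 : ∀ u v, ∃ x, G.Adj u x ∧ x ≠ v) :
    ∃ ℓ : Sym2 V → ℕ, (∀ e ∈ G.edgeSet, ℓ e ∈ ({1, 2, 3} : Set ℕ)) ∧
      ∀ u v, G.Adj u v → vertexProd G ℓ u ≠ vertexProd G ℓ v := by
  classical
  obtain ⟨S0, S1, s0, s1, l0, l1, dj, hne⟩ := codes G h2
  let ℓ : Sym2 V → ℕ := Sym2.lift ⟨fun u v => if S0 u v then 2 else if S1 u v then 3 else 1, by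
    intro u v
    have a0 : S0 u v ↔ S0 v u := ⟨s0 _ _, s0 _ _⟩
    have a1 : S1 u v ↔ S1 v u := ⟨s1 _ _, s1 _ _⟩
    simp only [a0, a1]⟩
  have hl : ∀ u v, ℓ s(u, v) = if S0 u v then 2 else if S1 u v then 3 else 1 := fun u v => rfl
  refine ⟨ℓ, ?_, ?_⟩
  · intro e _
    induction e with
    | _ a b => rw [hl]; split_ifs <;> simp
  · have hv := prod_code G S0 S1 l0 l1 dj ℓ (fun u v h => by rw [hl, if_pos h])
      (fun u v h => by rw [hl, if_neg (fun h' => dj _ _ h' h), if_pos h])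
      (fun u v h h' => by rw [hl, if_neg h, if_neg h'])
    intro u v hadj h
    rw [hv, hv] at h
    exact hne u v hadj (code_inj h)

end final

end MulLab

/-- Every finite simple `d`-regular graph with `d ≠ 1` (i.e. every nice regular
graph) admits a p-proper `3`-labelling of its edges: adjacent vertices receive
distinct products of incident labels. -/
theorem stmt_9 {V : Type*} [Fintype V] [DecidableEq V] (G : SimpleGraph V)
    [DecidableRel G.Adj] (d : ℕ) (hd : d ≠ 1) (hreg : G.IsRegularOfDegree d) :
    ∃ ℓ : Sym2 V → ℕ,
      (∀ e ∈ G.edgeSet, ℓ e ∈ ({1, 2, 3} : Set ℕ)) ∧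
      ∀ u v : V, G.Adj u v → vertexProd G ℓ u ≠ vertexProd G ℓ v := by
  rcases Nat.eq_zero_or_pos d with rfl | hpos
  · refine ⟨fun _ => 1, by simp, fun u v h => ?_⟩
    have h1 := hreg u
    rw [← SimpleGraph.card_neighborFinset_eq_degree, Finset.card_eq_zero] at h1
    have : v ∈ G.neighborFinset u := by simpa using h
    rw [h1] at this
    simp at this
  · apply MulLab.main_lab
    intro u v
    have h1 := hreg u
    rw [← SimpleGraph.card_neighborFinset_eq_degree] at h1
    obtain ⟨x, hx, hne⟩ := Finset.exists_mem_ne (s := G.neighborFinset u) (by omega) v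
    exact ⟨x, by simpa using hx, hne⟩
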